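/- arXiv:2510.11980 — 3 statements merged into one kernel-verified Lean document; each statement's English description precedes it below -/
import Mathlib

section
/- For every n ≥ 4, the number of consecutive equi-n-squares equals (Σ_{i=1}^{n} (−2)^{i+1} · C(n,i) · (n²−i·n)! / ((n−i)!)^n) − 4n·(n²−2n+1)!/((n−1)!·(n−2)!^{n−1}) + 8·⌊n/2⌋·(n²−3n+2)!/((n−2)!²·(n−3)!^{n−2}) − 2·⌊n/2⌋·(n²−4n+4)!/((n−2)!²·(n−4)!^{n−2}), as an equality of rational numbers. -/
open Nat Finset Filter

/-- An equi-`n`-square: an `n × n` array with entries in `Fin n` in which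
every value appears exactly `n` times. -/
def IsEquiSquare (n : ℕ) (g : Fin n → Fin n → Fin n) : Prop :=
  ∀ k : Fin n, Nat.card {p : Fin n × Fin n // g p.1 p.2 = k} = n

/-- Row `i` is consecutive (1-indexed: entry in column `j` is `j`). -/
def RowConsec {n : ℕ} (g : Fin n → Fin n → Fin n) (i : Fin n) : Prop :=
  ∀ j : Fin n, g i j = j

/-- Row `i` is reverse-consecutive (1-indexed: entry in column `j` is `n+1-j`). -/
def RowRevConsec {n : ℕ} (g : Fin n → Fin n → Fin n) (i : Fin n) : Prop :=
  ∀ j : Fin n, (g i j : ℕ) + (j : ℕ) + 1 = n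

/-- Column `j` is consecutive (1-indexed: entry in row `i` is `i`). -/
def ColConsec {n : ℕ} (g : Fin n → Fin n → Fin n) (j : Fin n) : Prop :=
  ∀ i : Fin n, g i j = i

/-- Column `j` is reverse-consecutive (1-indexed: entry in row `i` is `n+1-i`). -/
def ColRevConsec {n : ℕ} (g : Fin n → Fin n → Fin n) (j : Fin n) : Prop :=
  ∀ i : Fin n, (g i j : ℕ) + (i : ℕ) + 1 = n

/-- A consecutive equi-`n`-square: an equi-`n`-square with at least one consecutive or
reverse-consecutive row or column. -/
def IsConsecEquiSquare (n : ℕ) (g : Fin n → Fin n → Fin n) : Prop :=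
  IsEquiSquare n g ∧
    ((∃ i : Fin n, RowConsec g i ∨ RowRevConsec g i) ∨
      (∃ j : Fin n, ColConsec g j ∨ ColRevConsec g j))


lemma count_fibers {α ι : Type} [Fintype α] [Fintype ι] [DecidableEq α] [DecidableEq ι]
    (c : ι → ℕ) (hc : ∑ k, c k = Fintype.card α) :
    Nat.card {g : α → ι // ∀ k, Nat.card {a // g a = k} = c k} * ∏ k, (c k)! =
      (Fintype.card α)! := by
  classical
  let F := {g : α → ι // ∀ k, Nat.card {a // g a = k} = c k}
  let Φ : (Σ g : F, ∀ k, ({a // g.1 a = k} ≃ Fin (c k))) → (α ≃ Σ k, Fin (c k)) :=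
    fun x => (Equiv.sigmaFiberEquiv x.1.1).symm.trans (Equiv.sigmaCongrRight x.2)
  have hΦ : Function.Bijective Φ := by
    constructor
    · rintro ⟨⟨g, hg⟩, h⟩ ⟨⟨g', hg'⟩, h'⟩ heq
      have h1 : g = g' := by
        funext a
        have := congrArg (fun e => (e a).1) heq
        simpa [Φ, Equiv.sigmaFiberEquiv] using this
      subst h1
      congr 1
      funext k
      ext ⟨a, ha⟩
      subst ha
      have := DFunLike.congr_fun heq a
      simp [Φ, Equiv.sigmaFiberEquiv] at this
      rw [this]
    · intro e
      have hk : ∀ k, Nonempty ({a // (e a).1 = k} ≃ Fin (c k)) := fun k =>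
        ⟨(e.subtypeEquiv (q := fun x => x.1 = k) (fun a => Iff.rfl)).trans (Equiv.sigmaSubtype k)⟩
      refine ⟨⟨⟨fun a => (e a).1, fun k => ?_⟩, fun k =>
        (e.subtypeEquiv (q := fun x => x.1 = k) (fun a => Iff.rfl)).trans (Equiv.sigmaSubtype k)⟩, ?_⟩
      · obtain ⟨e'⟩ := hk k
        rw [Nat.card_congr e']; simp
      · ext1 a
        simp [Φ, Equiv.sigmaFiberEquiv, Equiv.sigmaSubtype]
  have h1 := Nat.card_congr (Equiv.ofBijective Φ hΦ)
  have h2 : Nat.card (α ≃ Σ k, Fin (c k)) = (Fintype.card α)! := by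
    have e : α ≃ Σ k, Fin (c k) := Fintype.equivOfCardEq (by simp [hc])
    rw [Nat.card_eq_fintype_card, Fintype.card_equiv e]
  have h3 : ∀ g : F, Nat.card (∀ k, ({a // g.1 a = k} ≃ Fin (c k))) = ∏ k, (c k)! := by
    intro g
    rw [Nat.card_pi]
    refine Finset.prod_congr rfl fun k _ => ?_
    have hg := g.2 k
    have e : {a // g.1 a = k} ≃ Fin (c k) := by
      apply Fintype.equivOfCardEq
      rw [← Nat.card_eq_fintype_card, hg]; simp
    rw [Nat.card_eq_fintype_card, Fintype.card_equiv e, ← Nat.card_eq_fintype_card, hg]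
  rw [← h2, ← h1, Nat.card_sigma]
  simp_rw [h3]
  simp [F, Nat.card_eq_fintype_card]

lemma count_ext {α ι : Type} [Fintype α] [Fintype ι] [DecidableEq α] [DecidableEq ι]
    (m : ι → ℕ) (hm : ∑ k, m k = Fintype.card α) (K : Finset α) (f : α → ι)
    (hc : ∀ k, #{p ∈ K | f p = k} ≤ m k) :
    #{g : α → ι | (∀ k, Nat.card {a // g a = k} = m k) ∧ ∀ p ∈ K, g p = f p} *
      ∏ k, (m k - #{p ∈ K | f p = k})! = (Fintype.card α - #K)! := by
  classical
  have hcard : Fintype.card {p // p ∉ K} = Fintype.card α - #K := by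
    rw [Fintype.card_subtype_compl]; simp
  have hK : ∑ k, #{p ∈ K | f p = k} = #K := 
    (Finset.card_eq_sum_card_fiberwise (fun _ _ => Finset.mem_coe.2 (Finset.mem_univ _))).symm
  rw [← hcard, ← count_fibers (fun k => m k - #{p ∈ K | f p = k})]
  · congr 1
    rw [← Fintype.card_subtype, ← Nat.card_eq_fintype_card]
    have key : ∀ (g : α → ι), (∀ p ∈ K, g p = f p) → ∀ k,
        Nat.card {a // g a = k} = Nat.card {a : {p // p ∉ K} // g a = k} + #{p ∈ K | f p = k} := by
      intro g hg k
      have e1 : #{p ∈ K | f p = k} = #{p | g p = k ∧ p ∈ K} := by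
        congr 1; ext p
        simp only [Finset.mem_filter, Finset.mem_univ, true_and]
        constructor
        · rintro ⟨h, h'⟩; exact ⟨(hg p h).trans h', h⟩
        · rintro ⟨h, h'⟩; exact ⟨h', (hg p h').symm.trans h⟩
      have e2 : Nat.card {a : {p // p ∉ K} // g a = k} = #{p | g p = k ∧ p ∉ K} := by
        rw [← Fintype.card_subtype, ← Nat.card_eq_fintype_card]
        refine Nat.card_congr ((Equiv.subtypeSubtypeEquivSubtypeInter _ (fun a => g a = k)).trans
          (Equiv.subtypeEquivRight fun a => and_comm))
      have e3 : Nat.card {a // g a = k} = #{p | g p = k} := by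
        rw [← Fintype.card_subtype, ← Nat.card_eq_fintype_card]
      rw [e1, e2, e3, ← Finset.filter_filter, ← Finset.filter_filter, add_comm,
        Finset.card_filter_add_card_filter_not]
    refine Nat.card_congr ⟨fun g => ⟨fun a => g.1 a, fun k => ?_⟩,
      fun g => ⟨fun a => if h : a ∈ K then f a else g.1 ⟨a, h⟩, ?_, ?_⟩, ?_, ?_⟩
    · have := key g.1 g.2.2 k
      rw [g.2.1 k] at this
      change Nat.card {a : {p // p ∉ K} // g.1 a = k} = _
      omega
    · intro k
      rw [key]
      · have := g.2 k
        have h2 := hc k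
        rw [show Nat.card {a : {p // p ∉ K} // (if h : (a:α) ∈ K then f a else g.1 ⟨a, h⟩) = k} = 
          Nat.card {a : {p // p ∉ K} // g.1 a = k} from Nat.card_congr (Equiv.subtypeEquivRight
            fun a => by simp [a.2]), this]
        omega
      · intro p hp; simp [hp]
    · intro p hp; simp [hp]
    · rintro ⟨g, hg1, hg2⟩
      ext a : 2
      by_cases h : a ∈ K
      · simp [h, hg2 a h]
      · simp [h]
    · rintro ⟨g, hg⟩
      ext a : 2
      simp [a.2]
  · rw [hcard, ← hm, ← hK, ← Finset.sum_tsub_distrib _ (fun k _ => hc k)]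

/-- `sv true` is the identity and `sv false` is the reversal. -/
def sv {n : ℕ} (s : Bool) (x : Fin n) : Fin n := if s then x else x.rev

lemma sv_sv {n : ℕ} (s : Bool) (x : Fin n) : sv s (sv s x) = x := by
  cases s <;> simp [sv]

lemma sv_eq_iff {n : ℕ} (s : Bool) (x y : Fin n) : sv s x = y ↔ x = sv s y := by
  constructor
  · rintro rfl; rw [sv_sv]
  · rintro rfl; rw [sv_sv]

open Classical in
/-- The number of equi-squares with prescribed rows `S` and columns `T`. -/
noncomputable def cnt {n : ℕ} (S T : Finset (Fin n)) (τ τ' : Fin n → Bool) : ℕ :=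
  #{g : Fin n → Fin n → Fin n | IsEquiSquare n g ∧ (∀ i ∈ S, ∀ j, g i j = sv (τ i) j) ∧
    (∀ j ∈ T, ∀ i, g i j = sv (τ' j) i)}

lemma count_ST {n : ℕ} (S T : Finset (Fin n)) (τ τ' : Fin n → Bool)
    (hcomp : ∀ i ∈ S, ∀ j ∈ T, sv (τ i) j = sv (τ' j) i) (hle : #S + #T ≤ n) :
    cnt S T τ τ' * ∏ k, (n - (#S + #T - #{p ∈ S ×ˢ T | sv (τ p.1) p.2 = k}))! =
      (n ^ 2 - (n * #S + n * #T - #S * #T))! := by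
  classical
  let K : Finset (Fin n × Fin n) := {p | p.1 ∈ S ∨ p.2 ∈ T}
  let f : Fin n × Fin n → Fin n := fun p => if p.1 ∈ S then sv (τ p.1) p.2 else sv (τ' p.2) p.1
  have hfib : ∀ k, #{p ∈ K | f p = k} = #S + #T - #{p ∈ S ×ˢ T | sv (τ p.1) p.2 = k} := by
    intro k
    let A : Finset (Fin n × Fin n) := S.image (fun i => (i, sv (τ i) k))
    let B : Finset (Fin n × Fin n) := T.image (fun j => (sv (τ' j) k, j))
    have hA : #A = #S := Finset.card_image_of_injective _ (fun a b h => (Prod.ext_iff.1 h).1)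
    have hB : #B = #T := Finset.card_image_of_injective _ (fun a b h => (Prod.ext_iff.1 h).2)
    have mA : ∀ p, p ∈ A ↔ p.1 ∈ S ∧ sv (τ p.1) p.2 = k := by
      rintro ⟨i, j⟩
      simp only [A, Finset.mem_image, Prod.mk.injEq]
      constructor
      · rintro ⟨a, ha, rfl, rfl⟩; exact ⟨ha, sv_sv _ _⟩
      · rintro ⟨ha, h⟩; exact ⟨i, ha, rfl, ((sv_eq_iff _ _ _).1 h).symm⟩
    have mB : ∀ p, p ∈ B ↔ p.2 ∈ T ∧ sv (τ' p.2) p.1 = k := by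
      rintro ⟨i, j⟩
      simp only [B, Finset.mem_image, Prod.mk.injEq]
      constructor
      · rintro ⟨a, ha, rfl, rfl⟩; exact ⟨ha, sv_sv _ _⟩
      · rintro ⟨ha, h⟩; exact ⟨j, ha, ((sv_eq_iff _ _ _).1 h).symm, rfl⟩
    have h1 : ({p ∈ K | f p = k} : Finset _) = A ∪ B := by
      ext p
      simp only [K, f, Finset.mem_filter, Finset.mem_univ, true_and, Finset.mem_union, mA, mB]
      by_cases h1 : p.1 ∈ S <;> by_cases h2 : p.2 ∈ T <;> simp [h1, h2]
      rw [hcomp _ h1 _ h2]; exact id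
    have h2 : ({p ∈ S ×ˢ T | sv (τ p.1) p.2 = k} : Finset _) = A ∩ B := by
      ext p
      simp only [Finset.mem_filter, Finset.mem_inter, mA, mB, Finset.mem_product]
      constructor
      · rintro ⟨⟨h1, h2⟩, h3⟩; exact ⟨⟨h1, h3⟩, h2, by rw [← hcomp _ h1 _ h2, h3]⟩
      · rintro ⟨⟨h1, h2⟩, h3, h4⟩; exact ⟨⟨h1, h3⟩, h2⟩
    have h3 := Finset.card_union_add_card_inter A B
    rw [h1, h2]
    omega
  have hK : #K = n * #S + n * #T - #S * #T := by
    have h1 : K = (S ×ˢ univ) ∪ (univ ×ˢ T) := by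
      ext p; simp [K]
    have h2 : (S ×ˢ T) = (S ×ˢ univ) ∩ (univ ×ˢ T) := by
      ext p; simp
    have h3 := Finset.card_union_add_card_inter (S ×ˢ (univ : Finset (Fin n))) (univ ×ˢ T)
    rw [← h1, ← h2] at h3
    simp only [Finset.card_product, Finset.card_univ, Fintype.card_fin] at h3
    rw [mul_comm n #S]
    omega
  have main := count_ext (fun _ : Fin n => n) (by simp) K f (by
    intro k; rw [hfib]; omega)
  simp_rw [hfib] at main
  rw [hK, Fintype.card_prod, Fintype.card_fin, ← pow_two] at main
  rw [← main]
  congr 1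
  unfold cnt
  rw [← Fintype.card_subtype, ← Fintype.card_subtype]
  refine Fintype.card_congr (Equiv.subtypeEquiv (Equiv.curry _ _ _).symm fun g => ?_)
  have e1 : (∀ p ∈ K, Function.uncurry g p = f p) ↔ (∀ i ∈ S, ∀ j, g i j = sv (τ i) j) ∧
    (∀ j ∈ T, ∀ i, g i j = sv (τ' j) i) := by
    constructor
    · intro h
      refine ⟨fun i hi j => ?_, fun j hj i => ?_⟩
      · have := h (i, j) (by simp [K, hi])
        simpa [f, hi] using this
      · have := h (i, j) (by simp [K, hj])
        by_cases hi : i ∈ S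
        · rw [← hcomp i hi j hj]; simpa [f, hi] using this
        · simpa [f, hi] using this
    · rintro ⟨h1, h2⟩ ⟨i, j⟩ hp
      by_cases hi : i ∈ S
      · simp [f, hi, h1 i hi j]
      · have hj : j ∈ T := by simpa [K, hi] using hp
        simp [f, hi, h2 j hj i]
  rw [← e1]
  exact Iff.rfl

lemma sv_inj {n : ℕ} (s : Bool) : Function.Injective (sv (n := n) s) := fun a b h => by
  rw [← sv_sv s a, h, sv_sv]

lemma sv_not {n : ℕ} (s : Bool) (x : Fin n) : sv (!s) x = sv s x.rev := by
  cases s <;> simp [sv]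

lemma sv_rev {n : ℕ} (s : Bool) (x : Fin n) : sv s x.rev = (sv s x).rev := by
  cases s <;> simp [sv]

lemma overlap {n : ℕ} (S T : Finset (Fin n)) (τ : Fin n → Bool) (k : Fin n) :
    #{p ∈ S ×ˢ T | sv (τ p.1) p.2 = k} = #{a ∈ S | sv (τ a) k ∈ T} := by
  symm
  refine Finset.card_bij (fun a _ => (a, sv (τ a) k)) ?_ ?_ ?_
  · intro a ha
    simp only [Finset.mem_filter, Finset.mem_product] at ha ⊢
    exact ⟨ha, sv_sv _ _⟩
  · intro a _ b _ h
    exact (Prod.ext_iff.1 h).1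
  · rintro ⟨a, b⟩ h
    simp only [Finset.mem_filter, Finset.mem_product] at h
    have h2 := (sv_eq_iff _ _ _).1 h.2
    refine ⟨a, ?_, ?_⟩
    · simp only [Finset.mem_filter]
      rw [← h2]; exact h.1
    · rw [← h2]

lemma cnt_rows {n : ℕ} (S : Finset (Fin n)) (τ τ' : Fin n → Bool) :
    (cnt S ∅ τ τ' : ℚ) = ((n ^ 2 - #S * n)! : ℚ) / ((n - #S)! : ℚ) ^ n := by
  have hS : #S ≤ n := by simpa using Finset.card_le_univ S
  have h := count_ST S ∅ τ τ' (by simp) (by simpa using hS)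
  simp only [Finset.product_empty, Finset.filter_empty, Finset.card_empty, add_zero, mul_zero,
    tsub_zero, Finset.prod_const, Finset.card_univ, Fintype.card_fin] at h
  rw [eq_div_iff (by positivity), mul_comm #S n]
  exact_mod_cast h

lemma cnt_col {n : ℕ} (S : Finset (Fin n)) (j : Fin n) (τ τ' : Fin n → Bool)
    (hcomp : ∀ i ∈ S, sv (τ i) j = sv (τ' j) i) (hle : #S + 1 ≤ n) :
    (cnt S {j} τ τ' : ℚ) = ((n ^ 2 - (n * #S + n - #S))! : ℚ) /
      (((n - #S)! : ℚ) ^ #S * ((n - (#S + 1))! : ℚ) ^ (n - #S)) := by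
  have h := count_ST S {j} τ τ' (by simpa using hcomp) (by simpa using hle)
  have ho : ∀ k, #{p ∈ S ×ˢ {j} | sv (τ p.1) p.2 = k} = if sv (τ' j) k ∈ S then 1 else 0 := by
    intro k
    rw [overlap]
    have : ({a ∈ S | sv (τ a) k ∈ ({j} : Finset (Fin n))} : Finset _) =
        {a ∈ S | a = sv (τ' j) k} := by
      refine Finset.filter_congr fun a ha => ?_
      rw [Finset.mem_singleton, sv_eq_iff, hcomp a ha, eq_comm, sv_eq_iff]
    rw [this, Finset.filter_eq']
    split_ifs <;> simp
  have hU : #{k | sv (τ' j) k ∈ S} = #S := by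
    have : ({k | sv (τ' j) k ∈ S} : Finset (Fin n)) = S.image (sv (τ' j)) := by
      ext k
      simp only [Finset.mem_filter, Finset.mem_univ, true_and, Finset.mem_image]
      constructor
      · intro h; exact ⟨_, h, sv_sv _ _⟩
      · rintro ⟨a, ha, rfl⟩; rwa [sv_sv]
    rw [this, Finset.card_image_of_injective _ (sv_inj _)]
  have hU' : #{k | ¬ sv (τ' j) k ∈ S} = n - #S := by
    have := Finset.card_filter_add_card_filter_not (s := (univ : Finset (Fin n)))
      (fun k => sv (τ' j) k ∈ S)
    rw [hU, Finset.card_univ, Fintype.card_fin] at this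
    omega
  have hp : ∏ k : Fin n, (n - (#S + #({j} : Finset (Fin n)) -
      #{p ∈ S ×ˢ {j} | sv (τ p.1) p.2 = k}))! =
      ((n - #S)!) ^ #S * ((n - (#S + 1))!) ^ (n - #S) := by
    have : ∀ k : Fin n, (n - (#S + #({j} : Finset (Fin n)) -
      #{p ∈ S ×ˢ {j} | sv (τ p.1) p.2 = k}))! =
      if sv (τ' j) k ∈ S then (n - #S)! else (n - (#S + 1))! := by
      intro k
      rw [ho]
      split_ifs <;> simp
    simp_rw [this]
    rw [Finset.prod_ite, Finset.prod_const, Finset.prod_const, hU, hU']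
  rw [hp] at h
  rw [eq_div_iff (by positivity)]
  simp only [Finset.card_singleton, mul_one] at h
  exact_mod_cast h

lemma cnt_four {n : ℕ} (hn : 4 ≤ n) (i : Fin n) (hi : i ≠ i.rev) (τ τ' : Fin n → Bool)
    (hcomp : ∀ a ∈ ({i, i.rev} : Finset (Fin n)), ∀ b ∈ ({i, i.rev} : Finset (Fin n)),
      sv (τ a) b = sv (τ' b) a) :
    (cnt {i, i.rev} {i, i.rev} τ τ' : ℚ) = ((n ^ 2 - 4 * n + 4)! : ℚ) /
            (((n - 2)! : ℚ) ^ 2 * ((n - 4)! : ℚ) ^ (n - 2)) := by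
  have hc : #({i, i.rev} : Finset (Fin n)) = 2 := Finset.card_pair hi
  have h := count_ST {i, i.rev} {i, i.rev} τ τ' hcomp (by rw [hc]; exact hn)
  have ho : ∀ k, #{p ∈ ({i, i.rev} : Finset (Fin n)) ×ˢ {i, i.rev} | sv (τ p.1) p.2 = k} =
      if k ∈ ({i, i.rev} : Finset (Fin n)) then 2 else 0 := by
    intro k
    rw [overlap]
    have : ∀ a, sv (τ a) k ∈ ({i, i.rev} : Finset (Fin n)) ↔ k ∈ ({i, i.rev} : Finset (Fin n)) := by
      intro a
      cases τ a <;> simp [sv, Fin.rev_eq_iff, or_comm]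
    simp only [this]
    split_ifs with hk
    · rw [Finset.filter_true_of_mem (fun _ _ => hk), hc]
    · rw [Finset.filter_false_of_mem (fun _ _ => hk), Finset.card_empty]
  simp only [ho, hc] at h
  have hp : ∏ k : Fin n, (n - (2 + 2 - if k ∈ ({i, i.rev} : Finset (Fin n)) then 2 else 0))! =
      ((n - 2)!) ^ 2 * ((n - 4)!) ^ (n - 2) := by
    have h2 : #(({i, i.rev} : Finset (Fin n))ᶜ) = n - 2 := by
      rw [Finset.card_compl, hc, Fintype.card_fin]
    rw [← Finset.prod_mul_prod_compl ({i, i.rev} : Finset (Fin n))]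
    congr 1
    · rw [Finset.prod_congr rfl (g := fun _ => (n - 2)!) fun k hk => by rw [if_pos hk],
        Finset.prod_const, hc]
    · rw [Finset.prod_congr rfl (g := fun _ => (n - 4)!) fun k hk => by
        rw [if_neg (Finset.mem_compl.1 hk)], Finset.prod_const, h2]
  rw [hp] at h
  rw [eq_div_iff (by positivity), show n ^ 2 - 4 * n + 4 = n ^ 2 - (n * 2 + n * 2 - 2 * 2) by
    have : 4 * n ≤ n ^ 2 := by nlinarith
    omega]
  exact_mod_cast h

lemma cnt_zero {n : ℕ} {S T : Finset (Fin n)} {τ τ' : Fin n → Bool} {i j : Fin n}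
    (hi : i ∈ S) (hj : j ∈ T) (h : sv (τ i) j ≠ sv (τ' j) i) : cnt S T τ τ' = 0 := by
  classical
  unfold cnt
  rw [Finset.card_eq_zero, Finset.filter_eq_empty_iff]
  rintro g - ⟨-, h1, h2⟩
  exact h ((h1 i hi j).symm.trans (h2 j hj i))

open Classical in
noncomputable def rowInd {n : ℕ} (g : Fin n → Fin n → Fin n) (i : Fin n) (s : Bool) : ℚ :=
  if ∀ j, g i j = sv s j then 1 else 0

def tr {n : ℕ} (g : Fin n → Fin n → Fin n) : Fin n → Fin n → Fin n := fun i j => g j i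

open Classical in
noncomputable def eqs (n : ℕ) : Finset (Fin n → Fin n → Fin n) := {g | IsEquiSquare n g}

lemma isEqui_tr {n : ℕ} (g : Fin n → Fin n → Fin n) (h : IsEquiSquare n g) :
    IsEquiSquare n (tr g) := by
  intro k
  exact (Nat.card_congr (Equiv.subtypeEquiv (Equiv.prodComm _ _) fun p => Iff.rfl)).trans (h k)

lemma sum_tr {n : ℕ} (F : (Fin n → Fin n → Fin n) → ℚ) :
    ∑ g ∈ eqs n, F (tr g) = ∑ g ∈ eqs n, F g := by
  refine Finset.sum_bij' (fun g _ => tr g) (fun g _ => tr g) ?_ ?_ ?_ ?_ ?_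
  · intro g hg; simp only [eqs, Finset.mem_filter, Finset.mem_univ, true_and] at hg ⊢
    exact isEqui_tr g hg
  · intro g hg; simp only [eqs, Finset.mem_filter, Finset.mem_univ, true_and] at hg ⊢
    exact isEqui_tr g hg
  · intros; rfl
  · intros; rfl
  · intros; rfl

lemma cnt_eq_sum {n : ℕ} (S T : Finset (Fin n)) (τ τ' : Fin n → Bool) :
    (cnt S T τ τ' : ℚ) = ∑ g ∈ eqs n, (∏ i ∈ S, rowInd g i (τ i)) *
      ∏ j ∈ T, rowInd (tr g) j (τ' j) := by
  classical
  unfold cnt eqs rowInd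
  have : ∀ (p q : Prop) [Decidable p] [Decidable q], ((if p then 1 else 0) * (if q then 1 else 0) : ℚ) =
      if p ∧ q then 1 else 0 := by
    intro p q _ _; by_cases p <;> by_cases q <;> simp_all
  rw [← Finset.filter_filter, Finset.card_filter]
  push_cast
  refine Finset.sum_congr rfl fun g _ => ?_
  rw [Finset.prod_boole, Finset.prod_boole, this]
  have hh : ∀ (p : Prop) (d1 d2 : Decidable p),
      (@ite ℚ p d1 1 0) = @ite ℚ p d2 1 0 := by
    intro p d1 d2; congr
  exact hh _ _ _

lemma rowInd_zero_or_one {n : ℕ} (g : Fin n → Fin n → Fin n) (i : Fin n) (s : Bool) :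
    rowInd g i s = 0 ∨ rowInd g i s = 1 := by
  unfold rowInd; split_ifs <;> simp

lemma rowInd_excl {n : ℕ} (hn : 4 ≤ n) (g : Fin n → Fin n → Fin n) (i : Fin n) (s : Bool) :
    rowInd g i s * rowInd g i (!s) = 0 := by
  unfold rowInd
  split_ifs with h1 h2 <;> simp
  have h3 := (h1 ⟨0, by omega⟩).symm.trans (h2 ⟨0, by omega⟩)
  rw [sv_not] at h3
  have := congrArg Fin.val (sv_inj _ h3)
  simp [Fin.rev] at this
  omega

/-- no good row -/
noncomputable def noRow {n : ℕ} (g : Fin n → Fin n → Fin n) : ℚ :=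
  ∏ i, (1 - ∑ s, rowInd g i s)

lemma noRow_eq_zero {n : ℕ} (hn : 4 ≤ n) (g : Fin n → Fin n → Fin n) (i : Fin n) (s : Bool)
    (h : rowInd g i s = 1) : noRow g = 0 := by
  refine Finset.prod_eq_zero (Finset.mem_univ i) ?_
  have := rowInd_excl hn g i s
  cases s <;> simp_all

lemma noRow_eq_one {n : ℕ} (g : Fin n → Fin n → Fin n) 
    (h : ∀ i s, rowInd g i s = 0) : noRow g = 1 := by
  simp [noRow, h]

lemma sum_noRow {n : ℕ} :
    ∑ g ∈ eqs n, (1 - noRow g) = ∑ i ∈ Finset.Icc 1 n, (-1 : ℚ) ^ (i + 1) * 2 ^ i * 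
      (n.choose i : ℚ) * ((n ^ 2 - i * n)! : ℚ) / ((n - i)! : ℚ) ^ n := by
  have h1 : ∀ g : Fin n → Fin n → Fin n, noRow g = ∑ S ∈ (univ : Finset (Fin n)).powerset,
      (-1) ^ #S * ((1 / 2) ^ (n - #S) * ∑ τ : Fin n → Bool, ∏ i ∈ S, rowInd g i (τ i)) := by
    intro g
    unfold noRow
    simp_rw [sub_eq_add_neg]
    rw [Finset.prod_one_add]
    refine Finset.sum_congr rfl fun S _ => ?_
    rw [Finset.prod_neg]
    congr 1
    have h2 : ∀ τ : Fin n → Bool, (1 / 2 : ℚ) ^ (n - #S) * ∏ i ∈ S, rowInd g i (τ i) =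
        ∏ i, if i ∈ S then rowInd g i (τ i) else 1 / 2 := by
      intro τ
      rw [Finset.prod_ite, Finset.prod_const, mul_comm]
      congr 1
      · simp
      · rw [Finset.filter_not, Finset.card_sdiff]; simp
    rw [Finset.mul_sum]
    simp_rw [h2]
    have := Finset.prod_univ_sum (fun _ : Fin n => (univ : Finset Bool)) 
      (fun i s => if i ∈ S then rowInd g i s else (1 / 2 : ℚ))
    rw [Fintype.piFinset_univ] at this
    rw [← this, ← Finset.prod_subset (Finset.subset_univ S)]
    · refine Finset.prod_congr rfl fun i hi => ?_
      simp [hi]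
    · intro i _ hi
      simp [hi]
  have h2 : ∑ g ∈ eqs n, noRow g = ∑ i ∈ Finset.range (n + 1), (n.choose i : ℚ) * ((-1) ^ i * 2 ^ i * 
      (((n ^ 2 - i * n)! : ℚ) / ((n - i)! : ℚ) ^ n)) := by
    simp_rw [h1]
    rw [Finset.sum_comm]
    have h3 : ∀ S ∈ (univ : Finset (Fin n)).powerset, ∑ g ∈ eqs n, 
        ((-1 : ℚ) ^ #S * ((1 / 2) ^ (n - #S) * ∑ τ : Fin n → Bool, ∏ i ∈ S, rowInd g i (τ i))) =
        (fun m => ((-1 : ℚ) ^ m * 2 ^ m * 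
      (((n ^ 2 - m * n)! : ℚ) / ((n - m)! : ℚ) ^ n))) #S := by
      intro S _
      have hS : #S ≤ n := by simpa using Finset.card_le_univ S
      rw [← Finset.mul_sum, ← Finset.mul_sum, Finset.sum_comm]
      have h4 : ∀ τ : Fin n → Bool, ∑ g ∈ eqs n, ∏ i ∈ S, rowInd g i (τ i) = 
          ((n ^ 2 - #S * n)! : ℚ) / ((n - #S)! : ℚ) ^ n := by
        intro τ
        rw [← cnt_rows S τ τ, cnt_eq_sum]
        simp
      simp_rw [h4]
      simp only [Finset.sum_const, Finset.card_univ, Fintype.card_pi, Fintype.card_bool, Finset.prod_const,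
        Fintype.card_fin, nsmul_eq_mul]
      have : (1 / 2 : ℚ) ^ (n - #S) * (2 ^ n : ℕ) = 2 ^ #S := by
        push_cast
        rw [one_div, inv_pow, inv_mul_eq_div, div_eq_iff (by positivity), ← pow_add]
        congr 1; omega
      rw [← this]; ring
    rw [Finset.sum_congr rfl h3]
    refine (Finset.sum_powerset_apply_card (fun m => ((-1 : ℚ) ^ m * 2 ^ m *
      (((n ^ 2 - m * n)! : ℚ) / ((n - m)! : ℚ) ^ n)))).trans ?_
    simp
  have h3 : ∑ g ∈ eqs n, (1 : ℚ) = (((n ^ 2)! : ℚ) / ((n)! : ℚ) ^ n) := by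
    have := cnt_rows (n := n) ∅ (fun _ => true) (fun _ => true)
    rw [cnt_eq_sum] at this
    simpa using this
  rw [Finset.sum_sub_distrib, h2, h3, Finset.range_eq_Ico, Finset.sum_eq_sum_Ico_succ_bot (by omega)]
  have : Finset.Ico (0 + 1) (n + 1) = Finset.Icc 1 n := by ext; simp
  rw [this]
  simp only [Nat.choose_zero_right, pow_zero, zero_mul, Nat.sub_zero, Nat.cast_one, one_mul]
  rw [sub_add_eq_sub_sub, sub_self, zero_sub, ← Finset.sum_neg_distrib]
  refine Finset.sum_congr rfl fun i _ => ?_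
  ring

def halfSet (n : ℕ) : Finset (Fin n) := {i | i < i.rev}

lemma card_halfSet (n : ℕ) : #(halfSet n) = n / 2 := by
  have : (halfSet n).map Fin.valEmbedding = Finset.range (n / 2) := by
    ext a
    simp only [halfSet, Finset.mem_map, Finset.mem_filter, Finset.mem_univ, true_and,
      Finset.mem_range, Fin.lt_def, Fin.val_rev]
    constructor
    · rintro ⟨i, hi, rfl⟩
      simp only [Fin.valEmbedding_apply]; omega
    · intro h
      exact ⟨⟨a, by omega⟩, by simp; omega, rfl⟩
  rw [← Finset.card_map Fin.valEmbedding, this, Finset.card_range]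

noncomputable def rr {n : ℕ} (g : Fin n → Fin n → Fin n) : ℚ := ∑ i, ∑ s, rowInd g i s

noncomputable def dd {n : ℕ} (g : Fin n → Fin n → Fin n) : ℚ :=
  ∑ i ∈ halfSet n, ∑ s, rowInd g i s * rowInd g i.rev (!s)

lemma one_sub_noRow {n : ℕ} (hn : 4 ≤ n) (g : Fin n → Fin n → Fin n) (j : Fin n) (t : Bool)
    (h : rowInd (tr g) j t = 1) : 1 - noRow g = rr g - dd g := by
  have hA : ∀ i s, rowInd g i s = (if i = j ∧ s = t then rowInd g j t else 0) +
      (if i = j.rev ∧ s = !t then rowInd g j.rev (!t) else 0) := by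
    intro i s
    by_cases hz : rowInd g i s = 0
    · rw [hz]
      split_ifs with h1 h2 h2
      · have := h1.2.symm.trans h2.2; simp at this
      · rw [← h1.1, ← h1.2, hz]; simp
      · rw [← h2.1, ← h2.2, hz]; simp
      · simp
    · have h1 : ∀ b, g i b = sv s b := by
        by_contra hc; exact hz (by simp [rowInd, hc])
      have h2 : ∀ b, tr g j b = sv t b := by
        by_contra hc; simp [rowInd, hc] at h
      have h3 : sv s j = sv t i := (h1 j).symm.trans (h2 i)
      by_cases hs : s = t
      · subst hs
        have := sv_inj _ h3
        subst this
        simp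
      · have hs' : s = !t := by cases s <;> cases t <;> simp_all
        subst hs'
        rw [sv_not] at h3
        have := sv_inj _ h3
        subst this
        simp
  have hr : rr g = rowInd g j t + rowInd g j.rev (!t) := by
    unfold rr
    obtain ⟨x, hx⟩ : ∃ x, x = rowInd g j t := ⟨_, rfl⟩
    obtain ⟨y, hy⟩ : ∃ y, y = rowInd g j.rev (!t) := ⟨_, rfl⟩
    simp only [← hx, ← hy] at hA ⊢
    clear hx hy
    simp_rw [hA, Finset.sum_add_distrib]
    congr 1
    · rw [Finset.sum_eq_single j, Finset.sum_eq_single t] <;> simp +contextual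
    · rw [Finset.sum_eq_single j.rev, Finset.sum_eq_single (!t)] <;> simp +contextual
  have hd : dd g = rowInd g j t * rowInd g j.rev (!t) := by
    have hz : ∀ i s, i ≠ j → i ≠ j.rev → rowInd g i s = 0 := by
      intro i s h1 h2
      rw [hA]; simp [h1, h2]
    unfold dd
    by_cases hj : j = j.rev
    · rw [← hj, rowInd_excl hn]
      refine Finset.sum_eq_zero fun i hi => Finset.sum_eq_zero fun s _ => ?_
      have hij : i ≠ j := by
        rintro rfl
        simp only [halfSet, Finset.mem_filter] at hi
        exact hi.2.ne hj
      rw [hz i s hij (hj ▸ hij), zero_mul]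
    · have e1 : rowInd g j (!t) = 0 := by rw [hA]; simp [hj]
      have e2 : rowInd g j.rev t = 0 := by rw [hA]; simp [Ne.symm hj]
      rcases lt_or_gt_of_ne hj with hlt | hgt
      · rw [Finset.sum_eq_single j]
        · clear hA hr hz; cases t <;> simp_all
        · intro i hi hij
          refine Finset.sum_eq_zero fun s _ => ?_
          rw [hz i s hij ?_, zero_mul]
          rintro rfl
          simp only [halfSet, Finset.mem_filter, Fin.rev_rev] at hi
          exact absurd hi.2 (not_lt.2 hlt.le)
        · simp [halfSet, hlt]
      · rw [Finset.sum_eq_single j.rev]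
        · rw [Fin.rev_rev]; clear hA hr hz; cases t <;> simp_all [mul_comm]
        · intro i hi hij
          refine Finset.sum_eq_zero fun s _ => ?_
          rw [hz i s ?_ hij, zero_mul]
          rintro rfl
          simp only [halfSet, Finset.mem_filter] at hi
          exact absurd hi.2 (not_lt.2 hgt.le)
        · simp [halfSet, hgt]
  rw [hr, hd]
  rcases rowInd_zero_or_one g j t with h1 | h1
  · rcases rowInd_zero_or_one g j.rev (!t) with h2 | h2
    · rw [noRow_eq_one g (fun i s => by rw [hA, h1, h2]; simp), h1, h2]; norm_num
    · rw [noRow_eq_zero hn g _ _ h2, h1, h2]; norm_num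
  · rw [noRow_eq_zero hn g _ _ h1, h1]; ring

lemma rr_dd_zero {n : ℕ} (g : Fin n → Fin n → Fin n) (h : ∀ i s, rowInd g i s = 0) :
    rr g - dd g = 0 := by
  simp [rr, dd, h]

lemma cross {n : ℕ} (hn : 4 ≤ n) (g : Fin n → Fin n → Fin n) :
    (1 - noRow g) * (1 - noRow (tr g)) = (rr g - dd g) * (rr (tr g) - dd (tr g)) := by
  by_cases h1 : ∀ i s, rowInd g i s = 0
  · rw [rr_dd_zero g h1, noRow_eq_one g h1]; ring
  by_cases h2 : ∀ i s, rowInd (tr g) i s = 0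
  · rw [rr_dd_zero _ h2, noRow_eq_one _ h2]; ring
  push Not at h1 h2
  obtain ⟨i, s, h1⟩ := h1
  obtain ⟨j, t, h2⟩ := h2
  rw [one_sub_noRow hn g j t ((rowInd_zero_or_one _ _ _).resolve_left h2),
    one_sub_noRow hn (tr g) i s ((rowInd_zero_or_one _ _ _).resolve_left h1)]

lemma sum_compat {n : ℕ} (i : Fin n) (V : ℚ) :
    ∑ s, ∑ j, ∑ t, (if sv s j = sv t i then V else 0) = 4 * V := by
  have h : ∀ s t : Bool, ∑ j, (if sv s j = sv t i then V else 0) = V := by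
    intro s t
    simp_rw [sv_eq_iff]
    simp
  have h2 : ∀ s : Bool, ∑ j, ∑ t, (if sv s j = sv t i then V else 0) = 2 * V := by
    intro s
    rw [Finset.sum_comm]
    simp_rw [h]
    simp
  simp_rw [h2]
  simp
  ring

lemma sum_compat_half {n : ℕ} (i : Fin n) (hi : i ∈ halfSet n) (V : ℚ) :
    ∑ s, ∑ j ∈ halfSet n, ∑ t, (if sv s j = sv t i then V else 0) = 2 * V := by
  have hi' : i.rev ∉ halfSet n := by
    simp only [halfSet, Finset.mem_filter, Finset.mem_univ, true_and, Fin.rev_rev] at hi ⊢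
    exact not_lt.2 hi.le
  have h : ∀ s : Bool, ∑ j ∈ halfSet n, ∑ t, (if sv s j = sv t i then V else 0) = V := by
    intro s
    rw [Finset.sum_comm]
    simp_rw [sv_eq_iff]
    cases s <;> simp [sv, hi, hi']
  simp_rw [h]
  simp

/-- types for the pair `i, rev i` -/
def pairType {n : ℕ} (i : Fin n) (s : Bool) : Fin n → Bool := fun a => if a = i then s else !s

lemma sum_rr_rr {n : ℕ} (hn : 4 ≤ n) : ∑ g ∈ eqs n, rr g * rr (tr g) =
    4 * (n : ℚ) * (((n ^ 2 - 2 * n + 1)! : ℚ) / (((n - 1)! : ℚ) * ((n - 2)! : ℚ) ^ (n - 1))) := by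
  obtain ⟨V, hV⟩ : ∃ V, V = (((n ^ 2 - 2 * n + 1)! : ℚ) /
    (((n - 1)! : ℚ) * ((n - 2)! : ℚ) ^ (n - 1))) := ⟨_, rfl⟩
  rw [← hV]
  have h : ∀ (i : Fin n) (s : Bool) (j : Fin n) (t : Bool),
      ∑ g ∈ eqs n, rowInd g i s * rowInd (tr g) j t = if sv s j = sv t i then V else 0 := by
    intro i s j t
    have h1 := cnt_eq_sum {i} {j} (fun _ => s) (fun _ => t)
    simp only [Finset.prod_singleton] at h1
    rw [← h1]
    split_ifs with hc
    · rw [cnt_col _ _ _ _ (by simpa using hc) (by simp; omega), hV]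
      have : 2 * n ≤ n ^ 2 := by nlinarith
      simp only [Finset.card_singleton, pow_one, mul_one]
      rw [show n ^ 2 - (n + n - 1) = n ^ 2 - 2 * n + 1 by omega]
    · rw [cnt_zero (Finset.mem_singleton_self i) (Finset.mem_singleton_self j) hc]; simp
  unfold rr
  simp_rw [Finset.sum_mul, Finset.mul_sum]
  rw [Finset.sum_comm]
  have h2 : ∀ i : Fin n, ∑ g ∈ eqs n, ∑ s, ∑ j, ∑ t, rowInd g i s * rowInd (tr g) j t = 4 * V := by
    intro i
    rw [← sum_compat i V, Finset.sum_comm]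
    refine Finset.sum_congr rfl fun s _ => ?_
    rw [Finset.sum_comm]
    refine Finset.sum_congr rfl fun j _ => ?_
    rw [Finset.sum_comm]
    exact Finset.sum_congr rfl fun t _ => h i s j t
  rw [Finset.sum_congr rfl fun i _ => h2 i]
  simp
  ring

lemma pair_compat {n : ℕ} {i j : Fin n} {s t : Bool} (hi : i ≠ i.rev) (hc : sv s j = sv t i) :
    ∀ a ∈ ({i, i.rev} : Finset (Fin n)), sv (pairType i s a) j = sv t a := by
  intro a ha
  rw [Finset.mem_insert, Finset.mem_singleton] at ha
  rcases ha with rfl | rfl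
  · simpa [pairType] using hc
  · simp only [pairType, if_neg hi.symm, sv_not, sv_rev, hc]

lemma prod_pairType {n : ℕ} (i : Fin n) (s : Bool) (hi : i ≠ i.rev) (g : Fin n → Fin n → Fin n) :
    ∏ a ∈ ({i, i.rev} : Finset (Fin n)), rowInd g a (pairType i s a) =
      rowInd g i s * rowInd g i.rev (!s) := by
  rw [Finset.prod_pair hi]
  simp [pairType, hi.symm]

lemma ne_of_half {n : ℕ} {i : Fin n} (hi : i ∈ halfSet n) : i ≠ i.rev := by
  simp only [halfSet, Finset.mem_filter, Finset.mem_univ, true_and] at hi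
  exact hi.ne

lemma sum_dd_rr {n : ℕ} (hn : 4 ≤ n) : ∑ g ∈ eqs n, dd g * rr (tr g) =
    4 * ((n / 2 : ℕ) : ℚ) * (((n ^ 2 - 3 * n + 2)! : ℚ) /
      (((n - 2)! : ℚ) ^ 2 * ((n - 3)! : ℚ) ^ (n - 2))) := by
  obtain ⟨V, hV⟩ : ∃ V, V = (((n ^ 2 - 3 * n + 2)! : ℚ) /
      (((n - 2)! : ℚ) ^ 2 * ((n - 3)! : ℚ) ^ (n - 2))) := ⟨_, rfl⟩
  rw [← hV]
  have h : ∀ i ∈ halfSet n, ∀ (s : Bool) (j : Fin n) (t : Bool),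
      ∑ g ∈ eqs n, rowInd g i s * rowInd g i.rev (!s) * rowInd (tr g) j t =
        if sv s j = sv t i then V else 0 := by
    intro i hi s j t
    have hi := ne_of_half hi
    have h1 := cnt_eq_sum {i, i.rev} {j} (pairType i s) (fun _ => t)
    simp only [Finset.prod_singleton, prod_pairType i s hi] at h1
    rw [← h1]
    split_ifs with hc
    · have h2 : #({i, i.rev} : Finset (Fin n)) = 2 := Finset.card_pair hi
      rw [cnt_col _ _ _ _ (pair_compat hi hc) (by rw [h2]; omega), hV, h2]
      have : 3 * n ≤ n ^ 2 := by nlinarith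
      rw [show n ^ 2 - (n * 2 + n - 2) = n ^ 2 - 3 * n + 2 by omega]
    · rw [cnt_zero (i := i) (j := j) (by simp) (by simp) (by simpa [pairType] using hc)]; simp
  unfold rr dd
  simp_rw [Finset.sum_mul, Finset.mul_sum]
  rw [Finset.sum_comm]
  have h2 : ∀ i ∈ halfSet n, ∑ g ∈ eqs n, ∑ s, ∑ j, ∑ t,
      rowInd g i s * rowInd g i.rev (!s) * rowInd (tr g) j t = 4 * V := by
    intro i hi
    rw [← sum_compat i V, Finset.sum_comm]
    refine Finset.sum_congr rfl fun s _ => ?_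
    rw [Finset.sum_comm]
    refine Finset.sum_congr rfl fun j _ => ?_
    rw [Finset.sum_comm]
    exact Finset.sum_congr rfl fun t _ => h i hi s j t
  rw [Finset.sum_congr rfl h2, Finset.sum_const, card_halfSet, nsmul_eq_mul]
  ring

lemma sum_dd_dd {n : ℕ} (hn : 4 ≤ n) : ∑ g ∈ eqs n, dd g * dd (tr g) =
    2 * ((n / 2 : ℕ) : ℚ) * (((n ^ 2 - 4 * n + 4)! : ℚ) /
      (((n - 2)! : ℚ) ^ 2 * ((n - 4)! : ℚ) ^ (n - 2))) := by
  obtain ⟨V, hV⟩ : ∃ V, V = (((n ^ 2 - 4 * n + 4)! : ℚ) /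
      (((n - 2)! : ℚ) ^ 2 * ((n - 4)! : ℚ) ^ (n - 2))) := ⟨_, rfl⟩
  rw [← hV]
  have h : ∀ i ∈ halfSet n, ∀ s : Bool, ∀ j ∈ halfSet n, ∀ t : Bool,
      ∑ g ∈ eqs n, rowInd g i s * rowInd g i.rev (!s) *
        (rowInd (tr g) j t * rowInd (tr g) j.rev (!t)) =
        if sv s j = sv t i then V else 0 := by
    intro i hi' s j hj' t
    have hi := ne_of_half hi'
    have hj := ne_of_half hj'
    have h1 := cnt_eq_sum {i, i.rev} {j, j.rev} (pairType i s) (pairType j t)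
    simp only [prod_pairType i s hi, prod_pairType j t hj] at h1
    rw [← h1]
    split_ifs with hc
    · have hij : j = i := by
        simp only [halfSet, Finset.mem_filter, Finset.mem_univ, true_and] at hi' hj'
        have h3 : j = i ∨ j = i.rev := by
          cases s <;> cases t <;> simp_all [sv, Fin.rev_eq_iff]
        rcases h3 with h3 | h3
        · exact h3
        · rw [h3, Fin.rev_rev] at hj'
          exact absurd hj' (not_lt.2 hi'.le)
      subst hij
      rw [cnt_four hn _ hi, hV]
      intro a ha b hb
      rw [Finset.mem_insert, Finset.mem_singleton] at hb
      rcases hb with rfl | rfl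
      · rw [pair_compat hi hc a ha]; simp [pairType]
      · rw [sv_rev, pair_compat hi hc a ha]; simp [pairType, hi.symm, sv_not, sv_rev]
    · rw [cnt_zero (i := i) (j := j) (by simp) (by simp) (by simpa [pairType] using hc)]; simp
  unfold dd
  simp_rw [Finset.sum_mul, Finset.mul_sum]
  rw [Finset.sum_comm]
  have h2 : ∀ i ∈ halfSet n, ∑ g ∈ eqs n, ∑ s, ∑ j ∈ halfSet n, ∑ t,
      rowInd g i s * rowInd g i.rev (!s) *
        (rowInd (tr g) j t * rowInd (tr g) j.rev (!t)) = 2 * V := by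
    intro i hi
    rw [← sum_compat_half i hi V, Finset.sum_comm]
    refine Finset.sum_congr rfl fun s _ => ?_
    rw [Finset.sum_comm]
    refine Finset.sum_congr rfl fun j hj => ?_
    rw [Finset.sum_comm]
    exact Finset.sum_congr rfl fun t _ => h i hi s j hj t
  rw [Finset.sum_congr rfl h2, Finset.sum_const, card_halfSet, nsmul_eq_mul]
  ring

lemma rowInd_iff {n : ℕ} (g : Fin n → Fin n → Fin n) (i : Fin n) :
    (RowConsec g i ∨ RowRevConsec g i) ↔ ∃ s, rowInd g i s ≠ 0 := by
  have h1 : RowConsec g i ↔ rowInd g i true ≠ 0 := by simp [RowConsec, rowInd, sv]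
  have h2 : RowRevConsec g i ↔ rowInd g i false ≠ 0 := by
    simp only [RowRevConsec, rowInd, sv, ne_eq, ite_eq_right_iff, one_ne_zero, imp_false, not_not,
      Fin.ext_iff, Fin.val_rev, Bool.false_eq_true, if_false]
    refine forall_congr' fun j => ?_
    have := j.2
    omega
  rw [h1, h2]
  constructor
  · rintro (h | h)
    · exact ⟨_, h⟩
    · exact ⟨_, h⟩
  · rintro ⟨s, h⟩
    cases s
    · exact Or.inr h
    · exact Or.inl h

lemma card_eq_sum {n : ℕ} (hn : 4 ≤ n) :
    (Nat.card {g : Fin n → Fin n → Fin n // IsConsecEquiSquare n g} : ℚ) =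
      ∑ g ∈ eqs n, (1 - noRow g * noRow (tr g)) := by
  classical
  rw [Nat.card_eq_fintype_card, Fintype.card_subtype]
  have hf : ({g | IsConsecEquiSquare n g} : Finset (Fin n → Fin n → Fin n)) =
      {g ∈ eqs n | (∃ i : Fin n, RowConsec g i ∨ RowRevConsec g i) ∨
      (∃ j : Fin n, ColConsec g j ∨ ColRevConsec g j)} := by
    ext g
    simp only [eqs, Finset.mem_filter, Finset.mem_univ, true_and]
    exact Iff.rfl
  rw [hf, Finset.card_filter]
  push_cast
  refine Finset.sum_congr rfl fun g _ => ?_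
  have hr : (∃ i, RowConsec g i ∨ RowRevConsec g i) ↔ ∃ i s, rowInd g i s ≠ 0 :=
    exists_congr fun i => rowInd_iff g i
  have hcol : (∃ i, ColConsec g i ∨ ColRevConsec g i) ↔ ∃ i s, rowInd (tr g) i s ≠ 0 :=
    exists_congr fun i => rowInd_iff (tr g) i
  split_ifs with h
  · rw [hr, hcol] at h
    rcases h with ⟨i, s, h⟩ | ⟨i, s, h⟩
    · rw [noRow_eq_zero hn g i s ((rowInd_zero_or_one _ _ _).resolve_left h)]; ring
    · rw [noRow_eq_zero hn (tr g) i s ((rowInd_zero_or_one _ _ _).resolve_left h)]; ring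
  · rw [hr, hcol] at h
    push Not at h
    rw [noRow_eq_one g h.1, noRow_eq_one _ h.2]; ring

/-- The exact count of consecutive equi-`n`-squares for `n ≥ 4`. -/
theorem card_consecEquiSquares (n : ℕ) (hn : 4 ≤ n) :
    (Nat.card {g : Fin n → Fin n → Fin n // IsConsecEquiSquare n g} : ℚ) =
      (∑ i ∈ Finset.Icc 1 n, (-2 : ℚ) ^ (i + 1) * (n.choose i : ℚ) *
          ((n ^ 2 - i * n)! : ℚ) / ((n - i)! : ℚ) ^ n)
        - 4 * (n : ℚ) * ((n ^ 2 - 2 * n + 1)! : ℚ) /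
            (((n - 1)! : ℚ) * ((n - 2)! : ℚ) ^ (n - 1))
        + 8 * ((n / 2 : ℕ) : ℚ) * ((n ^ 2 - 3 * n + 2)! : ℚ) /
            (((n - 2)! : ℚ) ^ 2 * ((n - 3)! : ℚ) ^ (n - 2))
        - 2 * ((n / 2 : ℕ) : ℚ) * ((n ^ 2 - 4 * n + 4)! : ℚ) /
            (((n - 2)! : ℚ) ^ 2 * ((n - 4)! : ℚ) ^ (n - 2)) := by
  have h1 : ∀ g : Fin n → Fin n → Fin n, 1 - noRow g * noRow (tr g) =
      (1 - noRow g) + (1 - noRow (tr g)) - (rr g * rr (tr g) - dd g * rr (tr g)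
        - dd (tr g) * rr (tr (tr g)) + dd g * dd (tr g)) := by
    intro g
    have := cross hn g
    have h2 : tr (tr g) = g := rfl
    rw [h2]
    linear_combination -this
  rw [card_eq_sum hn, Finset.sum_congr rfl fun g _ => h1 g]
  rw [Finset.sum_sub_distrib, Finset.sum_add_distrib, sum_tr (fun g => 1 - noRow g), sum_noRow,
    Finset.sum_add_distrib, Finset.sum_sub_distrib, Finset.sum_sub_distrib,
    sum_tr (fun g => dd g * rr (tr g)), sum_rr_rr hn, sum_dd_rr hn, sum_dd_dd hn,
    ← Finset.sum_add_distrib]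
  have h3 : ∀ i ∈ Finset.Icc 1 n, ((-1 : ℚ) ^ (i + 1) * 2 ^ i *
      (n.choose i : ℚ) * ((n ^ 2 - i * n)! : ℚ) / ((n - i)! : ℚ) ^ n +
      (-1 : ℚ) ^ (i + 1) * 2 ^ i *
      (n.choose i : ℚ) * ((n ^ 2 - i * n)! : ℚ) / ((n - i)! : ℚ) ^ n) =
      (-2 : ℚ) ^ (i + 1) * (n.choose i : ℚ) *
          ((n ^ 2 - i * n)! : ℚ) / ((n - i)! : ℚ) ^ n := by
    intro i _
    rw [show (-2 : ℚ) = (-1) * 2 by norm_num, mul_pow, pow_succ (2 : ℚ)]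
    ring
  rw [Finset.sum_congr rfl h3]
  ring
end

section
/- Let n ≥ 4. The number of equi-n-squares ω with X_n(ω) = 4, i.e. with exactly 4 consecutive or reverse-consecutive lines (rows plus columns), equals 2^5 · C(n,4) · (Σ_{k=0}^{n−4} (−2)^k · C(n−4,k) · (n²−4n−n·k)! / ((n−k−4)!)^n) + (n + 1_{even}(n) − 1) · (n²−4n+4)! / ((n−2)!² · (n−4)!^{n−2}), as an equality of rational numbers, where 1_{even}(n) is 1 if n is even and 0 otherwise. -/
open Nat Finset Filter

/-- `X_n(g)`: the number of consecutive or reverse-consecutive lines (rows plus columns)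
of the array `g`. -/
noncomputable def consecLineCount {n : ℕ} (g : Fin n → Fin n → Fin n) : ℕ :=
  Nat.card {i : Fin n // RowConsec g i ∨ RowRevConsec g i} +
    Nat.card {j : Fin n // ColConsec g j ∨ ColRevConsec g j}


section helpers
open Classical

/-- number of functions with prescribed fibre sizes -/
theorem aux_count {γ β : Type} [Fintype γ] [Fintype β] [DecidableEq γ] [DecidableEq β] (c : β → ℕ)
    (hc : ∑ k, c k = Fintype.card γ) :
    Nat.card {f : γ → β // ∀ k, Fintype.card {a // f a = k} = c k} * ∏ k, (c k)! =
      (Fintype.card γ)! := by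
  have hE : Fintype.card (γ ≃ Σ k, Fin (c k)) = (Fintype.card γ)! := by
    refine Fintype.card_equiv (Fintype.equivOfCardEq ?_)
    simp [hc]
  rw [← hE, Nat.card_eq_fintype_card]
  have hfst : ∀ e : γ ≃ Σ k, Fin (c k), ∀ k, Fintype.card {a // (e a).1 = k} = c k := by
    intro e k
    rw [Fintype.card_congr (β := {x : Σ k, Fin (c k) // x.1 = k})
      (e.subtypeEquiv (fun a => Iff.rfl)), Fintype.card_congr (Equiv.sigmaSubtype k)]
    simp
  let F : (γ ≃ Σ k, Fin (c k)) → {f : γ → β // ∀ k, Fintype.card {a // f a = k} = c k} :=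
    fun e => ⟨fun a => (e a).1, hfst e⟩
  rw [Fintype.card_congr (Equiv.sigmaFiberEquiv F).symm, Fintype.card_sigma]
  rw [Finset.sum_congr rfl (g := fun _ => ∏ k, (c k)!)]
  · simp
  rintro ⟨f, hf⟩ -
  have key : ∀ k, Nonempty ({a // f a = k} ≃ Fin (c k)) := fun k =>
    ⟨Fintype.equivOfCardEq (by simp [hf k])⟩
  let ef : γ ≃ Σ k, Fin (c k) :=
    (Equiv.sigmaFiberEquiv f).symm.trans (Equiv.sigmaCongrRight (fun k => (key k).some))
  have hef : ∀ a, (ef a).1 = f a := by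
    intro a
    simp [ef, Equiv.sigmaFiberEquiv]
  have h2 : ∀ x, f (ef.symm x) = x.1 := by
    intro x; rw [← hef]; simp
  have := DomMulAct.stabilizer_card f
  simp only [hf] at this
  rw [← this]
  refine Fintype.card_congr ?_
  refine ⟨fun e => ⟨e.1.trans ef.symm, ?_⟩, fun g => ⟨g.1.trans ef, ?_⟩, ?_, ?_⟩
  · ext1 a
    have := congrArg Subtype.val e.2
    simp only [F] at this
    simp [h2, congrFun this a]
  · apply Subtype.ext
    funext a
    simp only [F, Equiv.trans_apply, hef]
    exact congrFun g.2 a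
  · intro e; ext1; ext1 a; simp
  · intro e; ext1; ext1 a; simp

theorem aux_core {α β : Type} [Fintype α] [Fintype β] [DecidableEq α] [DecidableEq β] (P : Finset α) (h : α → β) (m : ℕ)
    (c : β → ℕ) (hcm : ∀ k, #{p ∈ P | h p = k} + c k = m)
    (hα : Fintype.card α = Fintype.card β * m) :
    #{g : α → β | (∀ k, #{p | g p = k} = m) ∧ ∀ p ∈ P, g p = h p} * ∏ k, (c k)! =
      (∑ k, c k)! := by
  have hγ : Fintype.card {p // p ∉ P} = Fintype.card α - #P := by
    rw [Fintype.card_subtype_compl]; simp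
  have hP : ∑ k, #{p ∈ P | h p = k} = #P :=
    (Finset.card_eq_sum_card_fiberwise (fun _ _ => Finset.mem_univ _)).symm
  have hsum : ∑ k, #{p ∈ P | h p = k} + ∑ k, c k = Fintype.card α := by
    rw [← Finset.sum_add_distrib, hα]; simp [hcm]
  have hs : ∑ k, c k = Fintype.card {p // p ∉ P} := by omega
  rw [hs, ← aux_count c hs]
  congr 1
  rw [← Fintype.card_coe, ← Nat.card_eq_fintype_card]
  have split : ∀ g : α → β, (∀ p ∈ P, g p = h p) → ∀ k, #{p | g p = k} =
      #{p ∈ P | h p = k} + Fintype.card {a : {p // p ∉ P} // g a = k} := by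
    intro g hg k
    rw [← Finset.card_filter_add_card_filter_not (s := {p | g p = k}) (fun p => p ∈ P)]
    congr 1
    · congr 1; ext p; simp only [mem_filter, mem_univ, true_and]
      constructor
      · rintro ⟨a, b⟩; exact ⟨b, by rw [← hg p b, a]⟩
      · rintro ⟨a, b⟩; exact ⟨by rw [hg p a, b], a⟩
    · rw [Fintype.card_congr (Equiv.subtypeSubtypeEquivSubtypeInter (fun p => p ∉ P) (fun p => g p = k)), Fintype.card_subtype]
      congr 1; ext p; simp [and_comm]
  refine Nat.card_congr ⟨fun g => ⟨fun a => g.1 a, ?_⟩,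
    fun f => ⟨fun a => if ha : a ∈ P then h a else f.1 ⟨a, ha⟩, ?_⟩, ?_, ?_⟩
  · intro k
    have hg := g.2
    simp only [mem_filter, mem_univ, true_and] at hg
    have e := split g.1 hg.2 k
    exact (Nat.add_left_cancel (((hcm k).trans (hg.1 k).symm).trans e)).symm
  · simp only [mem_filter, mem_univ, true_and]
    have h1 : ∀ p ∈ P, (if ha : p ∈ P then h p else f.1 ⟨p, ha⟩) = h p := by
      intro p hp; simp [hp]
    refine ⟨fun k => ?_, h1⟩
    rw [split _ h1 k, ← hcm k]
    congr 1
    rw [← f.2 k]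
    refine Fintype.card_congr (Equiv.subtypeEquivRight ?_)
    intro a; simp [a.2]
  · intro g
    have hg := g.2
    simp only [mem_filter, mem_univ, true_and] at hg
    ext1; funext a
    by_cases ha : a ∈ P
    · simp [ha, hg.2 a ha]
    · simp [ha]
  · intro f; ext1; funext a; simp [a.2]

theorem aux_core' {n : ℕ} (P : Finset (Fin n × Fin n)) (h : Fin n × Fin n → Fin n)
    (c : Fin n → ℕ) (hcm : ∀ k, #{p ∈ P | h p = k} + c k = n)  :
    #{g : Fin n → Fin n → Fin n | IsEquiSquare n g ∧ ∀ p ∈ P, g p.1 p.2 = h p} * ∏ k, (c k)! =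
      (∑ k, c k)! := by
  rw [← aux_core P h n c hcm (by simp)]
  congr 1
  refine Finset.card_bij (fun g _ p => g p.1 p.2) ?_ ?_ ?_
  · intro g hg
    simp only [mem_filter, mem_univ, true_and] at hg ⊢
    unfold IsEquiSquare at hg
    refine ⟨fun k => ?_, hg.2⟩
    have := hg.1 k
    rwa [Nat.card_eq_fintype_card, Fintype.card_subtype] at this
  · intro g _ g' _ h
    funext a b
    exact congrFun h (a, b)
  · intro f hf
    refine ⟨fun a b => f (a, b), ?_, rfl⟩
    simp only [mem_filter, mem_univ, true_and] at hf ⊢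
    unfold IsEquiSquare
    refine ⟨fun k => ?_, hf.2⟩
    rw [Nat.card_eq_fintype_card, Fintype.card_subtype]
    exact hf.1 k

theorem aux_rowRev {n : ℕ} (g : Fin n → Fin n → Fin n) (i : Fin n) :
    RowRevConsec g i ↔ ∀ j, g i j = Fin.rev j := by
  unfold RowRevConsec
  refine forall_congr' fun j => ?_
  rw [Fin.ext_iff, Fin.val_rev]
  omega

theorem aux_colRev {n : ℕ} (g : Fin n → Fin n → Fin n) (j : Fin n) :
    ColRevConsec g j ↔ ∀ i, g i j = Fin.rev i := by
  unfold ColRevConsec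
  refine forall_congr' fun j => ?_
  rw [Fin.ext_iff, Fin.val_rev]
  omega

theorem aux_not_both {n : ℕ} (hn : 2 ≤ n) (g : Fin n → Fin n → Fin n) (i : Fin n)
    (h1 : RowConsec g i) (h2 : RowRevConsec g i) : False := by
  rw [aux_rowRev] at h2
  have a := h1 ⟨0, by omega⟩
  rw [h2, Fin.ext_iff, Fin.val_rev] at a
  simp at a
  omega

noncomputable def auxR {n : ℕ} (g : Fin n → Fin n → Fin n) : Finset (Fin n) :=
  {i | RowConsec g i ∨ RowRevConsec g i}

noncomputable def auxC {n : ℕ} (g : Fin n → Fin n → Fin n) : Finset (Fin n) :=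
  {i | ColConsec g i ∨ ColRevConsec g i}

theorem aux_row1 {n : ℕ} (U V : Finset (Fin n)) (hV : V ⊆ U) :
    #{g : Fin n → Fin n → Fin n | IsEquiSquare n g ∧ (∀ i ∈ V, RowConsec g i) ∧
      ∀ i ∈ U \ V, RowRevConsec g i} * ((n - #U)!) ^ n = (n * (n - #U))! := by
  have hU : #U ≤ n := by simpa using Finset.card_le_univ U
  have := aux_core' (U ×ˢ univ) (fun p => if p.1 ∈ V then p.2 else Fin.rev p.2)
    (fun _ => n - #U) (by
      intro k
      have : #{p ∈ U ×ˢ (univ : Finset (Fin n)) |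
          (if p.1 ∈ V then p.2 else Fin.rev p.2) = k} = #U := by
        refine Finset.card_bij (fun p _ => p.1) ?_ ?_ ?_
        · intro p hp; simp at hp; exact hp.1
        · rintro ⟨a, b⟩ hp ⟨a', b'⟩ hp' h
          simp only [mem_filter, mem_product, mem_univ, and_true] at hp hp' h
          subst h
          have := hp.2.trans hp'.2.symm
          split_ifs at this
          · rw [this]
          · rw [Fin.rev_injective this]
        · intro a ha
          refine ⟨(a, if a ∈ V then k else Fin.rev k), ?_, rfl⟩
          simp only [mem_filter, mem_product, mem_univ, and_true]
          refine ⟨ha, ?_⟩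
          split_ifs <;> simp
      omega)
  simp only [prod_const, sum_const, Finset.card_univ, Fintype.card_fin, smul_eq_mul] at this
  rw [← this]
  congr 2
  ext g
  simp only [mem_filter, mem_univ, true_and, mem_product, Finset.mem_sdiff, and_true, aux_rowRev,
    RowConsec, Prod.forall, and_congr_right_iff]
  intro _
  constructor
  · rintro ⟨h1, h2⟩ a b ha
    split_ifs with h
    · exact h1 a h b
    · exact h2 a ⟨ha, h⟩ b
  · intro h
    refine ⟨fun a ha b => ?_, fun a ha b => ?_⟩
    · simpa [ha] using h a b (hV ha)
    · simpa [ha.2] using h a b ha.1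

noncomputable def auxN (n u : ℕ) : ℚ := ((n * (n - u))! : ℚ) / ((n - u)! : ℚ) ^ n

theorem aux_row2 {n : ℕ} (hn : 2 ≤ n) (U : Finset (Fin n)) :
    (#{g : Fin n → Fin n → Fin n | IsEquiSquare n g ∧ U ⊆ auxR g} : ℚ) =
      2 ^ #U * auxN n #U := by
  rw [Finset.card_eq_sum_card_fiberwise (f := fun g => {i ∈ U | RowConsec g i})
    (t := U.powerset) (fun g _ => by
      rw [mem_coe, mem_powerset]; exact Finset.filter_subset _ _)]
  push_cast
  rw [Finset.sum_congr rfl (g := fun _ => auxN n #U)]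
  · simp
  intro V hV
  rw [mem_powerset] at hV
  have := aux_row1 U V hV
  rw [auxN, eq_div_iff (by positivity), ← this]
  push_cast
  congr 3
  ext g
  simp only [mem_filter, mem_univ, true_and, and_assoc, and_congr_right_iff]
  intro _
  constructor
  · rintro ⟨h1, rfl⟩
    refine ⟨fun i hi => (mem_filter.1 hi).2, fun i hi => ?_⟩
    simp only [Finset.mem_sdiff, mem_filter, not_and] at hi
    have := h1 hi.1
    simp only [auxR, mem_filter, mem_univ, true_and] at this
    exact this.resolve_left (hi.2 hi.1)
  · rintro ⟨h1, h2⟩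
    refine ⟨fun i hi => ?_, ?_⟩
    · simp only [auxR, mem_filter, mem_univ, true_and]
      by_cases hiV : i ∈ V
      · exact Or.inl (h1 i hiV)
      · exact Or.inr (h2 i (by simp [hi, hiV]))
    · ext i
      simp only [mem_filter]
      refine ⟨fun h => ?_, fun h => ⟨hV h, h1 i h⟩⟩
      by_contra hiV
      exact aux_not_both hn g i h.2 (h2 i (by simp [h.1, hiV]))

theorem aux_ind {n : ℕ} (S R : Finset (Fin n)) :
    ∑ T ∈ Sᶜ.powerset, (-1 : ℚ) ^ #T * (if S ∪ T ⊆ R then 1 else 0) = if R = S then 1 else 0 := by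
  by_cases hS : S ⊆ R
  · have h1 : ∑ T ∈ Sᶜ.powerset, (-1 : ℚ) ^ #T * (if S ∪ T ⊆ R then 1 else 0) =
        ∑ T ∈ (R \ S).powerset, (-1 : ℚ) ^ #T := by
      simp only [mul_ite, mul_one, mul_zero]
      rw [← Finset.sum_filter]
      refine Finset.sum_congr ?_ fun _ _ => rfl
      ext T
      simp only [mem_filter, mem_powerset, Finset.subset_iff, mem_compl, mem_union, Finset.mem_sdiff]
      grind
    have h2 := Finset.sum_powerset_neg_one_pow_card (x := R \ S)
    have h3 : ∑ T ∈ (R \ S).powerset, (-1 : ℚ) ^ #T =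
      ((∑ T ∈ (R \ S).powerset, (-1 : ℤ) ^ #T : ℤ) : ℚ) := by push_cast; rfl
    rw [h1, h3, h2]
    have : R \ S = ∅ ↔ R = S := by
      rw [Finset.sdiff_eq_empty_iff_subset]
      exact ⟨fun h => h.antisymm hS, fun h => h.subset⟩
    simp [this]
  · have : R ≠ S := fun h => hS h.symm.subset
    rw [if_neg this]
    refine Finset.sum_eq_zero fun T _ => ?_
    rw [if_neg (fun h => hS (subset_union_left.trans h)), mul_zero]

theorem aux_row3 {n : ℕ} (hn : 2 ≤ n) (S : Finset (Fin n)) :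
    (#{g : Fin n → Fin n → Fin n | IsEquiSquare n g ∧ auxR g = S} : ℚ) =
      ∑ k ∈ range (n - #S + 1), ((n - #S).choose k : ℚ) *
        ((-1) ^ k * (2 ^ (#S + k) * auxN n (#S + k))) := by
  have h1 : (#{g : Fin n → Fin n → Fin n | IsEquiSquare n g ∧ auxR g = S} : ℚ) =
      ∑ T ∈ Sᶜ.powerset, (-1 : ℚ) ^ #T *
        (#{g : Fin n → Fin n → Fin n | IsEquiSquare n g ∧ S ∪ T ⊆ auxR g} : ℚ) := by
    have gen : ∀ (p : (Fin n → Fin n → Fin n) → Prop) [DecidablePred p],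
        (#{g : Fin n → Fin n → Fin n | IsEquiSquare n g ∧ p g} : ℚ) =
          ∑ g : Fin n → Fin n → Fin n with IsEquiSquare n g, if p g then (1 : ℚ) else 0 := by
      intro p _
      rw [← Finset.filter_filter, Finset.card_filter]
      push_cast
      rfl
    simp_rw [gen, Finset.mul_sum]
    rw [Finset.sum_comm]
    refine Finset.sum_congr rfl fun g _ => ?_
    convert (aux_ind S (auxR g)).symm
  rw [h1]
  have h2 : ∀ T ∈ Sᶜ.powerset, (-1 : ℚ) ^ #T *
        (#{g : Fin n → Fin n → Fin n | IsEquiSquare n g ∧ S ∪ T ⊆ auxR g} : ℚ) =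
        (fun k => (-1 : ℚ) ^ k * (2 ^ (#S + k) * auxN n (#S + k))) #T := by
    intro T hT
    rw [aux_row2 hn, Finset.card_union_of_disjoint]
    rw [mem_powerset] at hT
    exact Finset.disjoint_left.2 fun a ha hb => by simpa [ha] using hT hb
  rw [Finset.sum_congr rfl h2, Finset.sum_powerset_apply_card
    (fun k => (-1 : ℚ) ^ k * (2 ^ (#S + k) * auxN n (#S + k)))]
  simp [Finset.card_compl]

theorem aux_row4 {n : ℕ} (hn : 4 ≤ n) :
    (#{g : Fin n → Fin n → Fin n | IsEquiSquare n g ∧ #(auxR g) = 4} : ℚ) =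
      2 ^ 4 * (n.choose 4 : ℚ) *
          (∑ k ∈ Finset.range (n - 4 + 1), (-2 : ℚ) ^ k * ((n - 4).choose k : ℚ) *
            ((n ^ 2 - 4 * n - n * k)! : ℚ) / ((n - k - 4)! : ℚ) ^ n) := by
  rw [Finset.card_eq_sum_card_fiberwise (f := fun g => auxR g)
    (t := powersetCard 4 univ) (fun g hg => by simpa using (by simpa using hg : _ ∧ _).2)]
  push_cast
  have : ∀ S ∈ powersetCard 4 (univ : Finset (Fin n)),
      (#{g ∈ {g : Fin n → Fin n → Fin n | IsEquiSquare n g ∧ #(auxR g) = 4} | auxR g = S} : ℚ)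
        = ∑ k ∈ range (n - 4 + 1), ((n - 4).choose k : ℚ) *
        ((-1) ^ k * (2 ^ (4 + k) * auxN n (4 + k))) := by
    intro S hS
    have hS := (mem_powersetCard.1 hS).2
    have h := aux_row3 (by omega) S
    rw [hS] at h
    rw [← h]
    congr 2
    ext g
    simp only [mem_filter, mem_univ, true_and]
    constructor
    · rintro ⟨⟨a, b⟩, c⟩; exact ⟨a, c⟩
    · rintro ⟨a, c⟩; exact ⟨⟨a, by rw [c, hS]⟩, c⟩
  rw [Finset.sum_congr rfl this]
  simp only [sum_const, card_powersetCard, Finset.card_univ, Fintype.card_fin, nsmul_eq_mul]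
  rw [mul_comm (2 ^ 4 : ℚ), mul_assoc]
  congr 1
  rw [Finset.mul_sum]
  refine Finset.sum_congr rfl fun k hk => ?_
  rw [mem_range] at hk
  have e1 : n * (n - (4 + k)) = n ^ 2 - 4 * n - n * k := by
    rw [Nat.mul_sub, mul_add, ← Nat.sub_sub, sq, mul_comm n 4]
  have e2 : n - (4 + k) = n - k - 4 := by omega
  rw [auxN, e1, e2, pow_add]
  have : (-2 : ℚ) ^ k = (-1) ^ k * 2 ^ k := by rw [← mul_pow]; norm_num
  rw [this]
  ring

theorem mem_auxR {n : ℕ} {g : Fin n → Fin n → Fin n} {i : Fin n} :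
    i ∈ auxR g ↔ RowConsec g i ∨ RowRevConsec g i := by simp [auxR]

theorem mem_auxC {n : ℕ} {g : Fin n → Fin n → Fin n} {i : Fin n} :
    i ∈ auxC g ↔ ColConsec g i ∨ ColRevConsec g i := by simp [auxC]

theorem aux_col4 {n : ℕ} :
    #{g : Fin n → Fin n → Fin n | IsEquiSquare n g ∧ #(auxC g) = 4} =
    #{g : Fin n → Fin n → Fin n | IsEquiSquare n g ∧ #(auxR g) = 4} := by
  have hE : ∀ g : Fin n → Fin n → Fin n, IsEquiSquare n g → IsEquiSquare n (fun i j => g j i) := by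
    intro g hg k
    exact (Nat.card_congr ((Equiv.prodComm _ _).subtypeEquiv (fun _ => Iff.rfl))).trans (hg k)
  refine Finset.card_bij (fun g _ i j => g j i) ?_ ?_ ?_
  · intro g hg
    simp only [mem_filter, mem_univ, true_and] at hg ⊢
    exact ⟨hE g hg.1, hg.2⟩
  · intro g _ g' _ h
    funext a b
    exact congrFun (congrFun h b) a
  · intro g hg
    simp only [mem_filter, mem_univ, true_and] at hg
    refine ⟨fun i j => g j i, ?_, rfl⟩
    simp only [mem_filter, mem_univ, true_and]
    exact ⟨hE g hg.1, hg.2⟩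

theorem aux_cross {n : ℕ} (g : Fin n → Fin n → Fin n) (i j : Fin n)
    (hi : i ∈ auxR g) (hj : j ∈ auxC g) : i = j ∨ i = Fin.rev j := by
  simp only [auxR, auxC, mem_filter, mem_univ, true_and, aux_rowRev, aux_colRev, RowConsec,
    ColConsec] at hi hj
  rcases hi with hi | hi <;> rcases hj with hj | hj
  · left; rw [← hi j, hj i]
  · right; rw [← hi j, hj i, Fin.rev_rev]
  · right; rw [← hi j, hj i]
  · left; exact Fin.rev_injective (by rw [← hi j, hj i])

/-- the crossing configuration -/
def auxQ {n : ℕ} (i : Fin n) (g : Fin n → Fin n → Fin n) : Prop :=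
  (∀ j, g i j = j) ∧ (∀ j, g (Fin.rev i) j = Fin.rev j) ∧ (∀ j, g j i = j) ∧
    (∀ j, g j (Fin.rev i) = Fin.rev j)

theorem aux_R_sub {n : ℕ} (g : Fin n → Fin n → Fin n) (j : Fin n) (hj : j ∈ auxC g) :
    auxR g ⊆ {j, Fin.rev j} := by
  intro i hi
  simpa using aux_cross g i j hi hj

theorem aux_C_sub {n : ℕ} (g : Fin n → Fin n → Fin n) (i : Fin n) (hi : i ∈ auxR g) :
    auxC g ⊆ {i, Fin.rev i} := by
  intro j hj
  have := aux_cross g i j hi hj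
  simp only [mem_insert, mem_singleton]
  rcases this with h | h
  · exact Or.inl h.symm
  · right; rw [h, Fin.rev_rev]

theorem aux_22 {n : ℕ} (g : Fin n → Fin n → Fin n) :
    (#(auxR g) = 2 ∧ #(auxC g) = 2) ↔ ∃ i, i ≠ Fin.rev i ∧ auxQ i g := by
  constructor
  · rintro ⟨hR, hC⟩
    obtain ⟨j, hj⟩ : (auxC g).Nonempty := by rw [← Finset.card_pos]; omega
    have h1 : auxR g = {j, Fin.rev j} :=
      Finset.eq_of_subset_of_card_le (aux_R_sub g j hj) (by rw [hR]; exact Finset.card_le_two)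
    have hne : j ≠ Fin.rev j := by
      intro h; rw [h1, ← h] at hR; simp at hR
    have h2 : auxC g = {j, Fin.rev j} :=
      Finset.eq_of_subset_of_card_le (aux_C_sub g j (by simp [h1]))
        (by rw [hC]; exact Finset.card_le_two)
    have a1 : j ∈ auxR g := by simp [h1]
    have a2 : Fin.rev j ∈ auxR g := by simp [h1]
    have a3 : j ∈ auxC g := by simp [h2]
    have a4 : Fin.rev j ∈ auxC g := by simp [h2]
    simp only [auxR, auxC, mem_filter, mem_univ, true_and, aux_rowRev, aux_colRev, RowConsec,
      ColConsec] at a1 a2 a3 a4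
    have rr := Fin.rev_rev j
    rcases a1 with a1 | a1 <;> rcases a2 with a2 | a2 <;> rcases a3 with a3 | a3 <;>
      rcases a4 with a4 | a4 <;>
    first
    | exact ⟨j, hne, a1, a2, a3, a4⟩
    | exact ⟨Fin.rev j, by rw [rr]; exact hne.symm, a2, by rw [rr]; exact a1, a4,
        by rw [rr]; exact a3⟩
    | exfalso
      have b1 := a1 j
      have b2 := a1 j.rev
      have b3 := a2 j
      have b4 := a2 j.rev
      have b5 := a3 j
      have b6 := a3 j.rev
      have b7 := a4 j
      have b8 := a4 j.rev
      clear a1 a2 a3 a4 h1 h2 hR hC hj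
      grind
  · rintro ⟨i, hne, h1, h2, h3, h4⟩
    have a1 : i ∈ auxR g := mem_auxR.2 (Or.inl h1)
    have a2 : Fin.rev i ∈ auxR g := by simp [auxR, aux_rowRev, h2]
    have a3 : i ∈ auxC g := mem_auxC.2 (Or.inl h3)
    have a4 : Fin.rev i ∈ auxC g := by simp [auxC, aux_colRev, h4]
    have e1 : auxR g = {i, Fin.rev i} := (aux_R_sub g i a3).antisymm (by
      intro x hx; simp at hx; rcases hx with rfl | rfl <;> assumption)
    have e2 : auxC g = {i, Fin.rev i} := (aux_C_sub g i a1).antisymm (by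
      intro x hx; simp at hx; rcases hx with rfl | rfl <;> assumption)
    rw [e1, e2, Finset.card_pair hne]
    simp

theorem aux_Qcount {n : ℕ} (hn : 4 ≤ n) (i : Fin n) (hi : i ≠ Fin.rev i) :
    #{g : Fin n → Fin n → Fin n | IsEquiSquare n g ∧ auxQ i g} *
      ((n - 2)! ^ 2 * (n - 4)! ^ (n - 2)) = (n ^ 2 - 4 * n + 4)! := by
  have key := aux_core'
    ({p | p.1 = i ∨ p.1 = Fin.rev i ∨ p.2 = i ∨ p.2 = Fin.rev i} : Finset (Fin n × Fin n))
    (fun p => if p.1 = i then p.2 else if p.1 = Fin.rev i then Fin.rev p.2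
      else if p.2 = i then p.1 else Fin.rev p.1)
    (fun k => if k = i ∨ k = Fin.rev i then n - 2 else n - 4) (by
      intro k
      have rr := Fin.rev_rev i
      have rk := Fin.rev_rev k
      have e : ({p ∈ ({p | p.1 = i ∨ p.1 = Fin.rev i ∨ p.2 = i ∨ p.2 = Fin.rev i} :
          Finset (Fin n × Fin n)) | (if p.1 = i then p.2 else if p.1 = Fin.rev i then Fin.rev p.2
            else if p.2 = i then p.1 else Fin.rev p.1) = k}) =
          {(i, k), (Fin.rev i, Fin.rev k), (k, i), (Fin.rev k, Fin.rev i)} := by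
        ext ⟨a, b⟩
        have ra := Fin.rev_rev a
        have rb := Fin.rev_rev b
        simp only [mem_filter, mem_univ, true_and, mem_insert, mem_singleton, Prod.mk.injEq]
        grind
      rw [e]
      by_cases h1 : k = i
      · subst h1
        simp only [true_or, if_true]
        have : #({(k, k), (k.rev, k.rev), (k, k), (k.rev, k.rev)} : Finset (Fin n × Fin n)) = 2 := by
          rw [Finset.card_eq_two]
          refine ⟨(k, k), (k.rev, k.rev), by simp [hi], ?_⟩
          ext x; simp only [mem_insert, mem_singleton]; tauto
        omega
      by_cases h2 : k = Fin.rev i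
      · subst h2
        simp only [or_true, if_true, rr]
        have : #({(i, i.rev), (i.rev, i), (i.rev, i), (i, i.rev)} : Finset (Fin n × Fin n)) = 2 := by
          rw [Finset.card_eq_two]
          refine ⟨(i, i.rev), (i.rev, i), by simp [hi], ?_⟩
          ext x; simp only [mem_insert, mem_singleton]; tauto
        omega
      · have hk : k.rev ≠ i := fun h => h2 (by rw [← h, rk])
        have hk2 : k.rev ≠ i.rev := fun h => h1 (Fin.rev_injective h)
        rw [if_neg (by tauto), Finset.card_insert_of_notMem, Finset.card_insert_of_notMem,
          Finset.card_pair]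
        · omega
        · simp [hi]
        · simp [Ne.symm hk2, Ne.symm h2]
        · simp [hi, Ne.symm h1, Ne.symm hk])
  have hf : ({k | k = i ∨ k = Fin.rev i} : Finset (Fin n)) = {i, Fin.rev i} := by
    ext; simp
  have hc : #({k | k = i ∨ k = Fin.rev i} : Finset (Fin n)) = 2 := by
    rw [hf, Finset.card_pair hi]
  have hc' : #({k | ¬ (k = i ∨ k = Fin.rev i)} : Finset (Fin n)) = n - 2 := by
    have := Finset.card_filter_add_card_filter_not (s := (univ : Finset (Fin n)))
      (fun k => k = i ∨ k = Fin.rev i)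
    rw [hc] at this
    simp only [Finset.card_univ, Fintype.card_fin] at this
    omega
  have hprod : ∏ k : Fin n, (if k = i ∨ k = Fin.rev i then n - 2 else n - 4)! =
      (n - 2)! ^ 2 * (n - 4)! ^ (n - 2) := by
    simp only [apply_ite Nat.factorial]
    rw [Finset.prod_ite, prod_const, prod_const, hc, hc']
  have hsum : ∑ k : Fin n, (if k = i ∨ k = Fin.rev i then n - 2 else n - 4) =
      n ^ 2 - 4 * n + 4 := by
    rw [Finset.sum_ite, sum_const, sum_const, hc, hc']
    obtain ⟨m, rfl⟩ := Nat.exists_eq_add_of_le hn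
    have e1 : 4 + m - 2 = m + 2 := by omega
    have e2 : 4 + m - 4 = m := by omega
    have e3 : (4 + m) ^ 2 - 4 * (4 + m) = m * (m + 4) := by
      rw [Nat.sub_eq_iff_eq_add (by nlinarith)]; ring
    rw [e1, e2, e3, smul_eq_mul, smul_eq_mul]; ring
  rw [hprod, hsum] at key
  rw [← key]
  congr 2
  ext g
  simp only [mem_filter, mem_univ, true_and, and_congr_right_iff, Prod.forall]
  unfold auxQ
  intro _
  have rr := Fin.rev_rev i
  constructor
  · rintro ⟨h1, h2, h3, h4⟩ a b h
    split_ifs with c1 c2 c3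
    · rw [c1, h1]
    · rw [c2, h2]
    · rw [c3, h3]
    · have : b = i.rev := by tauto
      rw [this, h4]
  · intro h
    refine ⟨fun j => ?_, fun j => ?_, fun j => ?_, fun j => ?_⟩
    · have := h i j; grind
    · have := h i.rev j; grind
    · have := h j i; grind
    · have := h j i.rev; grind

theorem aux_revCount {n : ℕ} (hn : 4 ≤ n) :
    (#{i : Fin n | i ≠ Fin.rev i} : ℚ) = (n : ℚ) + (if Even n then 1 else 0) - 1 := by
  have h := Finset.card_filter_add_card_filter_not (s := (univ : Finset (Fin n)))
      (fun i => i = Fin.rev i)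
  simp only [Finset.card_univ, Fintype.card_fin] at h
  have h2 : #{i : Fin n | i = Fin.rev i} = if Even n then 0 else 1 := by
    split_ifs with he
    · rw [Finset.card_eq_zero, Finset.filter_eq_empty_iff]
      intro i _ hi
      rw [Fin.ext_iff, Fin.val_rev] at hi
      obtain ⟨r, hr⟩ := he
      omega
    · rw [Nat.not_even_iff_odd] at he
      obtain ⟨r, hr⟩ := he
      rw [Finset.card_eq_one]
      refine ⟨⟨r, by omega⟩, ?_⟩
      ext i
      simp only [mem_filter, mem_univ, true_and, mem_singleton, Fin.ext_iff, Fin.val_rev]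
      omega
  rw [h2] at h
  have h' : ((if Even n then 0 else 1 : ℕ) : ℚ) + (#{i : Fin n | i ≠ Fin.rev i} : ℚ) = n := by
    exact_mod_cast h
  rw [← h']
  split_ifs <;> push_cast <;> ring

theorem aux_22count {n : ℕ} (hn : 4 ≤ n) :
    (#{g : Fin n → Fin n → Fin n | IsEquiSquare n g ∧ (#(auxR g) = 2 ∧ #(auxC g) = 2)} : ℚ) =
      ((n : ℚ) + (if Even n then 1 else 0) - 1) * ((n ^ 2 - 4 * n + 4)! : ℚ) /
            (((n - 2)! : ℚ) ^ 2 * ((n - 4)! : ℚ) ^ (n - 2)) := by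
  have e : ({g : Fin n → Fin n → Fin n | IsEquiSquare n g ∧ (#(auxR g) = 2 ∧ #(auxC g) = 2)} :
      Finset _) = ({i : Fin n | i ≠ Fin.rev i} : Finset _).biUnion
        (fun i => {g : Fin n → Fin n → Fin n | IsEquiSquare n g ∧ auxQ i g}) := by
    ext g
    simp only [mem_filter, mem_univ, true_and, mem_biUnion, aux_22]
    constructor
    · rintro ⟨a, i, b, c⟩; exact ⟨i, b, a, c⟩
    · rintro ⟨i, b, a, c⟩; exact ⟨a, i, b, c⟩
  rw [e, Finset.card_biUnion]
  · push_cast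
    have : ∀ i ∈ ({i : Fin n | i ≠ Fin.rev i} : Finset _),
        (#{g : Fin n → Fin n → Fin n | IsEquiSquare n g ∧ auxQ i g} : ℚ) =
          ((n ^ 2 - 4 * n + 4)! : ℚ) / (((n - 2)! : ℚ) ^ 2 * ((n - 4)! : ℚ) ^ (n - 2)) := by
      intro i hi
      rw [eq_div_iff (by positivity)]
      exact_mod_cast aux_Qcount hn i (by simpa using hi)
    rw [Finset.sum_congr rfl this, sum_const, nsmul_eq_mul, aux_revCount hn, mul_div_assoc]
  · intro i hi j hj hij
    refine Finset.disjoint_left.2 fun g h1 h2 => ?_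
    simp only [mem_filter, mem_univ, true_and] at h1 h2
    obtain ⟨-, a1, a2, a3, a4⟩ := h1
    obtain ⟨-, b1, b2, b3, b4⟩ := h2
    have : i ∈ auxR g := mem_auxR.2 (Or.inl a1)
    have hj' : j ∈ auxC g := mem_auxC.2 (Or.inl b3)
    rcases aux_cross g i j this hj' with h | h
    · exact hij h
    · exact aux_not_both (by omega) g i a1 (by rw [aux_rowRev, h]; exact b2)

theorem aux_lines {n : ℕ} (g : Fin n → Fin n → Fin n) :
    consecLineCount g = 4 ↔ (#(auxR g) = 4 ∨ #(auxC g) = 4) ∨ (#(auxR g) = 2 ∧ #(auxC g) = 2) := by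
  have h : consecLineCount g = #(auxR g) + #(auxC g) := by
    unfold consecLineCount auxR auxC
    rw [Nat.card_eq_fintype_card, Nat.card_eq_fintype_card, Fintype.card_subtype,
      Fintype.card_subtype]
  rw [h]
  have h1 : 0 < #(auxC g) → #(auxR g) ≤ 2 := by
    intro hc
    obtain ⟨j, hj⟩ := Finset.card_pos.1 hc
    exact (Finset.card_le_card (aux_R_sub g j hj)).trans Finset.card_le_two
  have h2 : 0 < #(auxR g) → #(auxC g) ≤ 2 := by
    intro hc
    obtain ⟨j, hj⟩ := Finset.card_pos.1 hc
    exact (Finset.card_le_card (aux_C_sub g j hj)).trans Finset.card_le_two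
  omega

theorem aux_main (n : ℕ) (hn : 4 ≤ n) :
    (Nat.card {g : Fin n → Fin n → Fin n //
        IsEquiSquare n g ∧ consecLineCount g = 4} : ℚ) =
      2 ^ 5 * (n.choose 4 : ℚ) *
          (∑ k ∈ Finset.range (n - 4 + 1), (-2 : ℚ) ^ k * ((n - 4).choose k : ℚ) *
            ((n ^ 2 - 4 * n - n * k)! : ℚ) / ((n - k - 4)! : ℚ) ^ n)
        + ((n : ℚ) + (if Even n then 1 else 0) - 1) * ((n ^ 2 - 4 * n + 4)! : ℚ) /
            (((n - 2)! : ℚ) ^ 2 * ((n - 4)! : ℚ) ^ (n - 2)) := by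
  have h0 := aux_22count hn
  have h1 := aux_row4 hn
  have h2 := aux_col4 (n := n)
  rw [Nat.card_eq_fintype_card, Fintype.card_subtype]
  simp only [aux_lines, and_or_left, Finset.filter_or]
  rw [Finset.card_union_of_disjoint, Finset.card_union_of_disjoint, h2]
  · push_cast
    rw [h1, h0]
    ring
  · refine Finset.disjoint_left.2 fun g a b => ?_
    simp only [mem_filter, mem_univ, true_and] at a b
    obtain ⟨j, hj⟩ := Finset.card_pos.1 (by omega : 0 < #(auxC g))
    have := (Finset.card_le_card (aux_R_sub g j hj)).trans Finset.card_le_two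
    omega
  · refine Finset.disjoint_left.2 fun g a b => ?_
    simp only [mem_filter, mem_univ, true_and, mem_union] at a b
    omega
end helpers

/-- For `n ≥ 4`, the number of equi-`n`-squares with exactly `4` consecutive or
reverse-consecutive lines. -/
theorem card_equiSquares_lineCount_four (n : ℕ) (hn : 4 ≤ n) :
    (Nat.card {g : Fin n → Fin n → Fin n //
        IsEquiSquare n g ∧ consecLineCount g = 4} : ℚ) =
      2 ^ 5 * (n.choose 4 : ℚ) *
          (∑ k ∈ Finset.range (n - 4 + 1), (-2 : ℚ) ^ k * ((n - 4).choose k : ℚ) *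
            ((n ^ 2 - 4 * n - n * k)! : ℚ) / ((n - k - 4)! : ℚ) ^ n)
        + ((n : ℚ) + (if Even n then 1 else 0) - 1) * ((n ^ 2 - 4 * n + 4)! : ℚ) /
            (((n - 2)! : ℚ) ^ 2 * ((n - 4)! : ℚ) ^ (n - 2)) := by
  exact aux_main n hn
end

section
/- Let n ≥ 4. The number of equi-n-squares ω with X_n(ω) = 3, i.e. with exactly 3 consecutive or reverse-consecutive lines (rows plus columns), equals 2^4 · C(n,3) · (Σ_{k=0}^{n−3} (−2)^k · C(n−3,k) · (n²−3n−n·k)! / ((n−k−3)!)^n) + 4(n + 1_{even}(n) − 1) · (n²−3n+2)! / ((n−2)!² · (n−3)!^{n−2}) − 4(n + 1_{even}(n) − 1) · (n²−4n+4)! / ((n−2)!² · (n−4)!^{n−2}), as an equality of rational numbers, where 1_{even}(n) is 1 if n is even and 0 otherwise. -/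
open Nat Finset Filter

section aux

lemma core_count {α β : Type} [Fintype α] [DecidableEq α] [Fintype β] [DecidableEq β]
    (T : Finset α) : ∀ (c : β → ℕ) (h : α → β), ∑ k, c k = #T →
    #(univ.filter fun g : α → β => (∀ x, x ∉ T → g x = h x) ∧ ∀ k, #(T.filter (fun x => g x = k)) = c k)
      * ∏ k, (c k)! = (#T)! := by
  induction T using Finset.induction_on with
  | empty =>
    intro c h hc
    have hc0 : ∀ k, c k = 0 := by
      intro k
      have := Finset.single_le_sum (f := c) (fun i _ => Nat.zero_le _) (Finset.mem_univ k)
      simp at hc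
      exact hc k
    have : (univ.filter fun g : α → β => (∀ x, x ∉ (∅ : Finset α) → g x = h x) ∧
        ∀ k, #((∅ : Finset α).filter (fun x => g x = k)) = c k) = {h} := by
      ext g
      simp [hc0, funext_iff]
    rw [this]
    simp [hc0]
  | insert a T ha ih =>
    intro c h hc
    rw [Finset.card_insert_of_notMem ha] at hc
    rw [Finset.card_eq_sum_card_fiberwise (f := fun g : α → β => g a) (t := univ)
      (by intro x _; simp), Finset.sum_mul]
    have key : ∀ k : β, #((univ.filter fun g : α → β => (∀ x, x ∉ insert a T → g x = h x) ∧
        ∀ k, #((insert a T).filter (fun x => g x = k)) = c k).filter (fun g => g a = k))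
        * ∏ k, (c k)! = c k * (#T)! := by
      intro k
      by_cases hk : c k = 0
      · have : ((univ.filter fun g : α → β => (∀ x, x ∉ insert a T → g x = h x) ∧
          ∀ k, #((insert a T).filter (fun x => g x = k)) = c k).filter (fun g => g a = k)) = ∅ := by
          apply Finset.eq_empty_of_forall_notMem
          intro g hg
          simp only [Finset.mem_filter, Finset.mem_univ, true_and] at hg
          have h1 := hg.1.2 k
          rw [hk, Finset.card_eq_zero] at h1
          have : a ∈ (insert a T).filter (fun x => g x = k) := by simp [hg.2]
          rw [h1] at this
          simp at this
        rw [this, hk]; simp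
      · have hsum : ∑ l, Function.update c k (c k - 1) l = #T := by
          have h1 := Finset.sum_update_of_mem (Finset.mem_univ k) c (c k - 1)
          have h2 := Finset.add_sum_erase univ c (Finset.mem_univ k)
          rw [← Finset.sdiff_singleton_eq_erase] at h2
          omega
        have hprod : ∏ l, (c l)! = c k * ∏ l, (Function.update c k (c k - 1) l)! := by
          rw [← Finset.mul_prod_erase univ (fun l => (c l)!) (Finset.mem_univ k),
            ← Finset.mul_prod_erase univ (fun l => (Function.update c k (c k - 1) l)!) (Finset.mem_univ k)]
          have : ∏ x ∈ univ.erase k, (Function.update c k (c k - 1) x)! = ∏ x ∈ univ.erase k, (c x)! := by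
            apply Finset.prod_congr rfl
            intro x hx
            rw [Function.update_of_ne (Finset.ne_of_mem_erase hx)]
          rw [this, Function.update_self, ← mul_assoc, Nat.mul_factorial_pred hk]
        have hset : ((univ.filter fun g : α → β => (∀ x, x ∉ insert a T → g x = h x) ∧
          ∀ k, #((insert a T).filter (fun x => g x = k)) = c k).filter (fun g => g a = k)) =
          (univ.filter fun g : α → β => (∀ x, x ∉ T → g x = Function.update h a k x) ∧
          ∀ l, #(T.filter (fun x => g x = l)) = Function.update c k (c k - 1) l) := by
          ext g
          simp only [Finset.mem_filter, Finset.mem_univ, true_and]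
          have hcard : ∀ l, #((insert a T).filter (fun x => g x = l)) =
              #(T.filter (fun x => g x = l)) + if g a = l then 1 else 0 := by
            intro l
            rw [Finset.filter_insert]
            split_ifs with hl
            · rw [Finset.card_insert_of_notMem (by simp [ha])]
            · rfl
          simp only [hcard]
          constructor
          · rintro ⟨⟨h1, h2⟩, h3⟩
            refine ⟨?_, ?_⟩
            · intro x hx
              by_cases hxa : x = a
              · subst hxa; simp [h3]
              · rw [Function.update_of_ne hxa]; exact h1 x (by simp [hxa, hx])
            · intro l
              have := h2 l
              by_cases hl : l = k
              · subst hl; simp [h3] at this ⊢; omega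
              · rw [Function.update_of_ne hl]; rw [h3, if_neg (Ne.symm hl)] at this; simpa using this
          · rintro ⟨h1, h2⟩
            have h3 : g a = k := by have := h1 a ha; simpa using this
            refine ⟨⟨?_, ?_⟩, h3⟩
            · intro x hx
              simp only [Finset.mem_insert, not_or] at hx
              rw [h1 x hx.2, Function.update_of_ne hx.1]
            · intro l
              have := h2 l
              by_cases hl : l = k
              · subst hl; simp [h3] at this ⊢; omega
              · rw [Function.update_of_ne hl] at this; rw [h3, if_neg (Ne.symm hl)]; simpa using this
        rw [hset, hprod, Nat.mul_left_comm, ih _ _ hsum]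
    rw [Finset.sum_congr rfl (fun k _ => key k), ← Finset.sum_mul, hc,
      Finset.card_insert_of_notMem ha, Nat.factorial_succ]

open scoped Classical in
lemma pat_count {n : ℕ} (S : Finset (Fin n × Fin n)) (h : Fin n → Fin n → Fin n) (c : Fin n → ℕ)
    (hc : ∀ k, #(S.filter (fun p => h p.1 p.2 = k)) + c k = n) :
    #(univ.filter fun g : Fin n → Fin n → Fin n => IsEquiSquare n g ∧ ∀ p ∈ S, g p.1 p.2 = h p.1 p.2)
      * ∏ k, (c k)! = (∑ k, c k)! := by
  have hS : #S = ∑ k, #(S.filter (fun p => h p.1 p.2 = k)) :=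
    Finset.card_eq_sum_card_fiberwise (f := fun p : Fin n × Fin n => h p.1 p.2) (t := univ)
      (by intro x _; simp)
  have htot : ∑ k, (#(S.filter (fun p => h p.1 p.2 = k)) + c k) = n * n := by
    rw [Finset.sum_congr rfl (fun k _ => hc k)]; simp
  rw [Finset.sum_add_distrib, ← hS] at htot
  have hcompl : #S + #Sᶜ = n * n := by
    rw [Finset.card_add_card_compl]; simp
  have hsum : ∑ k, c k = #Sᶜ := by omega
  rw [hsum, ← core_count Sᶜ c (fun p => h p.1 p.2) hsum]
  congr 1
  refine Finset.card_bij' (fun g _ => fun p => g p.1 p.2) (fun f _ => fun a b => f (a, b)) ?_ ?_ ?_ ?_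
  · intro g hg
    simp only [Finset.mem_filter, Finset.mem_univ, true_and] at hg ⊢
    refine ⟨fun x hx => hg.2 x (by simpa using hx), fun k => ?_⟩
    have h1 := hg.1 k
    rw [Nat.card_eq_fintype_card, Fintype.card_subtype] at h1
    have h2 : #(S.filter (fun p => g p.1 p.2 = k)) = #(S.filter (fun p => h p.1 p.2 = k)) := by
      congr 1
      apply Finset.filter_congr
      intro x hx
      rw [hg.2 x hx]
    have h3 : #(univ.filter (fun p : Fin n × Fin n => g p.1 p.2 = k)) =
      #(S.filter (fun p => g p.1 p.2 = k)) + #(Sᶜ.filter (fun p => g p.1 p.2 = k)) := by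
      rw [← Finset.card_union_of_disjoint (Finset.disjoint_filter_filter disjoint_compl_right),
        ← Finset.filter_union, Finset.union_compl]
    have := hc k
    omega
  · intro f hf
    simp only [Finset.mem_filter, Finset.mem_univ, true_and] at hf ⊢
    have hg : ∀ p ∈ S, f (p.1, p.2) = h p.1 p.2 := fun x hx => hf.1 x (by simpa using hx)
    refine ⟨fun k => ?_, hg⟩
    rw [Nat.card_eq_fintype_card, Fintype.card_subtype]
    have h2 : #(S.filter (fun p => f (p.1, p.2) = k)) = #(S.filter (fun p => h p.1 p.2 = k)) := by
      congr 1
      apply Finset.filter_congr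
      intro x hx
      rw [hg x hx]
    have h3 : #(univ.filter (fun p : Fin n × Fin n => f (p.1, p.2) = k)) =
      #(S.filter (fun p => f (p.1, p.2) = k)) + #(Sᶜ.filter (fun p => f (p.1, p.2) = k)) := by
      rw [← Finset.card_union_of_disjoint (Finset.disjoint_filter_filter disjoint_compl_right),
        ← Finset.filter_union, Finset.union_compl]
    have h4 := hc k
    have h5 := hf.2 k
    simp only [Prod.mk.eta] at *
    omega
  · intros; rfl
  · intros; rfl

end aux

section aux2

/-- The symbol expected at position `x` of a line with sign `s`. -/
def sg {n : ℕ} (s : Bool) (x : Fin n) : Fin n := if s then x else x.rev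

/-- Row `i` has sign `s`. -/
def RowS {n : ℕ} (g : Fin n → Fin n → Fin n) (s : Bool) (i : Fin n) : Prop := ∀ j, g i j = sg s j

/-- Column `j` has sign `s`. -/
def ColS {n : ℕ} (g : Fin n → Fin n → Fin n) (s : Bool) (j : Fin n) : Prop := ∀ i, g i j = sg s i

lemma rev_iff {n : ℕ} (x y : Fin n) : x = y.rev ↔ (x : ℕ) + y + 1 = n := by
  rw [Fin.ext_iff, Fin.val_rev]; omega

lemma sg_sg {n : ℕ} (s : Bool) (x : Fin n) : sg s (sg s x) = x := by
  cases s <;> simp [sg]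

lemma sg_eq_iff {n : ℕ} (s : Bool) (x y : Fin n) : sg s x = y ↔ x = sg s y := by
  constructor
  · rintro rfl; rw [sg_sg]
  · rintro rfl; rw [sg_sg]

lemma sg_cross {n : ℕ} {s t : Bool} {x y : Fin n} (h : sg s x = sg t y) : x = sg (s == t) y := by
  rw [sg_eq_iff] at h
  cases s <;> cases t <;> simpa [sg] using h

lemma cross_s12 {n : ℕ} {g : Fin n → Fin n → Fin n} {s t : Bool} {i j : Fin n}
    (hi : RowS g s i) (hj : ColS g t j) : j = sg (s == t) i :=
  sg_cross ((hi j).symm.trans (hj i))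

lemma sg_sign {n : ℕ} (hn : 2 ≤ n) {s t : Bool} (h : ∀ x : Fin n, sg s x = sg t x) : s = t := by
  have := h ⟨0, by omega⟩
  cases s <;> cases t <;> simp [sg, Fin.ext_iff, Fin.val_rev] at this ⊢ <;> omega

lemma rowS_unique {n : ℕ} (hn : 2 ≤ n) {g : Fin n → Fin n → Fin n} {s t : Bool} {i : Fin n}
    (h : RowS g s i) (h' : RowS g t i) : s = t :=
  sg_sign hn fun x => (h x).symm.trans (h' x)

lemma colS_unique {n : ℕ} (hn : 2 ≤ n) {g : Fin n → Fin n → Fin n} {s t : Bool} {i : Fin n}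
    (h : ColS g s i) (h' : ColS g t i) : s = t :=
  sg_sign hn fun x => (h x).symm.trans (h' x)

open scoped Classical in
/-- Rows that are consecutive or reverse-consecutive. -/
noncomputable def rowSet {n : ℕ} (g : Fin n → Fin n → Fin n) : Finset (Fin n) :=
  univ.filter fun i => ∃ s, RowS g s i

open scoped Classical in
/-- Columns that are consecutive or reverse-consecutive. -/
noncomputable def colSet {n : ℕ} (g : Fin n → Fin n → Fin n) : Finset (Fin n) :=
  univ.filter fun i => ∃ s, ColS g s i

open scoped Classical in
/-- The finset of equi-squares. -/
noncomputable def EQ (n : ℕ) : Finset (Fin n → Fin n → Fin n) := univ.filter (IsEquiSquare n)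

lemma mem_rowSet {n : ℕ} {g : Fin n → Fin n → Fin n} {i : Fin n} :
    i ∈ rowSet g ↔ ∃ s, RowS g s i := by simp [rowSet]

lemma mem_colSet {n : ℕ} {g : Fin n → Fin n → Fin n} {i : Fin n} :
    i ∈ colSet g ↔ ∃ s, ColS g s i := by simp [colSet]

lemma mem_EQ {n : ℕ} {g : Fin n → Fin n → Fin n} : g ∈ EQ n ↔ IsEquiSquare n g := by simp [EQ]

lemma lineCount_eq {n : ℕ} (g : Fin n → Fin n → Fin n) :
    consecLineCount g = #(rowSet g) + #(colSet g) := by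
  classical
  unfold consecLineCount
  rw [Nat.card_eq_fintype_card, Nat.card_eq_fintype_card, Fintype.card_subtype, Fintype.card_subtype]
  congr 2
  · ext i
    rw [Finset.mem_filter, mem_rowSet]
    simp [RowConsec, RowRevConsec, RowS, sg, or_comm, rev_iff]
  · ext i
    rw [Finset.mem_filter, mem_colSet]
    simp [ColConsec, ColRevConsec, ColS, sg, or_comm, rev_iff]

lemma rowSet_subset {n : ℕ} {g : Fin n → Fin n → Fin n} {t : Bool} {j : Fin n} (h : ColS g t j) :
    rowSet g ⊆ {j, j.rev} := by
  intro i hi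
  obtain ⟨s, hs⟩ := mem_rowSet.1 hi
  have := cross_s12 hs h
  rw [eq_comm, sg_eq_iff] at this
  cases s <;> cases t <;> simp_all [sg]

lemma colSet_subset {n : ℕ} {g : Fin n → Fin n → Fin n} {t : Bool} {i : Fin n} (h : RowS g t i) :
    colSet g ⊆ {i, i.rev} := by
  intro j hj
  obtain ⟨s, hs⟩ := mem_colSet.1 hj
  have := cross_s12 h hs
  cases s <;> cases t <;> simp_all [sg]

lemma colSet_card_zero {n : ℕ} {g : Fin n → Fin n → Fin n} (h : 3 ≤ #(rowSet g)) :
    #(colSet g) = 0 := by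
  rw [Finset.card_eq_zero]
  apply Finset.eq_empty_of_forall_notMem
  intro j hj
  obtain ⟨t, ht⟩ := mem_colSet.1 hj
  have h1 := Finset.card_le_card (rowSet_subset ht)
  have h2 := Finset.card_le_two (a := j) (b := j.rev)
  omega

lemma EQ_flip {n : ℕ} {g : Fin n → Fin n → Fin n} (h : g ∈ EQ n) : flip g ∈ EQ n := by
  rw [mem_EQ] at *
  intro k
  refine Eq.trans ?_ (h k)
  apply Nat.card_congr
  exact (Equiv.prodComm _ _).subtypeEquiv (fun p => by simp [flip])

lemma card_flip {n : ℕ} (a b : ℕ) :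
    #((EQ n).filter fun g => #(rowSet g) = a ∧ #(colSet g) = b) =
    #((EQ n).filter fun g => #(rowSet g) = b ∧ #(colSet g) = a) := by
  refine Finset.card_bij' (fun g _ => flip g) (fun g _ => flip g) ?_ ?_ ?_ ?_
  · intro g hg
    rw [Finset.mem_filter] at *
    exact ⟨EQ_flip hg.1, hg.2.2, hg.2.1⟩
  · intro g hg
    rw [Finset.mem_filter] at *
    exact ⟨EQ_flip hg.1, hg.2.2, hg.2.1⟩
  · intros; rfl
  · intros; rfl

lemma total_split {n : ℕ} :
    Nat.card {g : Fin n → Fin n → Fin n // IsEquiSquare n g ∧ consecLineCount g = 3} =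
    2 * #((EQ n).filter fun g => #(rowSet g) = 3) +
    2 * #((EQ n).filter fun g => #(rowSet g) = 2 ∧ #(colSet g) = 1) := by
  classical
  rw [Nat.card_eq_fintype_card, Fintype.card_subtype]
  have h0 : (univ.filter fun g : Fin n → Fin n → Fin n => IsEquiSquare n g ∧ consecLineCount g = 3) =
    (EQ n).filter fun g => #(rowSet g) + #(colSet g) = 3 := by
    ext g; simp [mem_EQ, lineCount_eq]
  have h1 : ((EQ n).filter fun g => #(rowSet g) = 3) =
      (EQ n).filter fun g => #(rowSet g) = 3 ∧ #(colSet g) = 0 := by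
    apply Finset.filter_congr
    intro g _
    constructor
    · intro h; exact ⟨h, colSet_card_zero h.ge⟩
    · exact fun h => h.1
  rw [h0, h1, two_mul, two_mul]
  nth_rw 2 [card_flip]
  nth_rw 4 [card_flip]
  rw [← Finset.card_union_of_disjoint, ← Finset.card_union_of_disjoint,
    ← Finset.card_union_of_disjoint]
  · congr 1
    ext g
    simp only [Finset.mem_filter, Finset.mem_union]
    constructor
    · rintro ⟨h, h'⟩
      simp only [h, true_and]
      omega
    · rintro ((h | h) | (h | h)) <;> exact ⟨h.1, by omega⟩
  all_goals
    rw [Finset.disjoint_left]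
    intro g hg hg'
    simp only [Finset.mem_filter, Finset.mem_union] at hg hg'
    omega

lemma N_count {n : ℕ} (hn : 2 ≤ n) (U : Finset (Fin n)) :
    #((EQ n).filter fun g => U ⊆ rowSet g) * ((n - #U)!) ^ n = 2 ^ #U * (n * (n - #U))! := by
  classical
  rw [Finset.card_eq_sum_card_fiberwise (f := fun g => U.filter fun i => RowS g true i)
    (t := U.powerset)
    (by intro g _; exact Finset.mem_coe.2 (Finset.mem_powerset.2 (Finset.filter_subset _ _))), Finset.sum_mul, ← Finset.card_powerset,
    ← smul_eq_mul (a := #U.powerset), ← Finset.sum_const]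
  apply Finset.sum_congr rfl
  intro V hV
  rw [Finset.mem_powerset] at hV
  have hp := pat_count (n := n) (U ×ˢ univ) (fun i j => sg (decide (i ∈ V)) j) (fun _ => n - #U) (by
    intro k
    have : ((U ×ˢ univ).filter fun p : Fin n × Fin n => sg (decide (p.1 ∈ V)) p.2 = k) =
      U.image fun i => (i, sg (decide (i ∈ V)) k) := by
      ext ⟨a, b⟩
      simp only [Finset.mem_filter, Finset.mem_product, Finset.mem_univ, and_true,
        Finset.mem_image, Prod.mk.injEq]
      rw [sg_eq_iff]
      constructor
      · rintro ⟨h1, h2⟩; exact ⟨a, h1, rfl, h2.symm⟩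
      · rintro ⟨a', h1, rfl, h2⟩; exact ⟨h1, h2.symm⟩
    rw [this, Finset.card_image_of_injective _ (fun x y h => by simpa using congrArg Prod.fst h)]
    have := Finset.card_le_univ U
    simp at this
    omega)
  simp only [Finset.prod_const, Finset.sum_const, Finset.card_univ, Fintype.card_fin, smul_eq_mul] at hp
  rw [← hp]
  congr 2
  ext g
  simp only [Finset.mem_filter, Finset.mem_univ, true_and, mem_EQ, Finset.mem_product, and_true]
  rw [and_assoc]
  apply and_congr_right
  intro _
  constructor
  · rintro ⟨h1, rfl⟩ ⟨i, j⟩ hp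
    simp only at hp
    obtain ⟨s, hs⟩ := mem_rowSet.1 (h1 hp)
    rw [show decide (i ∈ U.filter fun i => RowS g true i) = s from ?_]
    · exact hs j
    · cases s
      · simp only [Finset.mem_filter, hp, true_and, decide_eq_false_iff_not]
        intro h; exact absurd (rowS_unique hn hs h) (by simp)
      · simp [hp, hs]
  · intro h
    have h' : ∀ i ∈ U, RowS g (decide (i ∈ V)) i := fun i hi j => h (i, j) hi
    refine ⟨fun i hi => mem_rowSet.2 ⟨_, h' i hi⟩, ?_⟩
    ext i
    simp only [Finset.mem_filter]
    constructor
    · rintro ⟨h1, h2⟩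
      simpa using rowS_unique hn (h' i h1) h2
    · intro h1
      refine ⟨hV h1, ?_⟩
      simpa [h1] using h' i (hV h1)

lemma incl_excl {n : ℕ} (T : Finset (Fin n)) :
    (#((EQ n).filter fun g => rowSet g = T) : ℚ) =
      ∑ W ∈ Tᶜ.powerset, (-1) ^ #W * (#((EQ n).filter fun g => T ∪ W ⊆ rowSet g) : ℚ) := by
  classical
  simp only [Finset.card_filter, Nat.cast_sum, Finset.mul_sum]
  rw [Finset.sum_comm]
  apply Finset.sum_congr rfl
  intro g _
  by_cases hT : T ⊆ rowSet g
  · have h1 : ∑ W ∈ Tᶜ.powerset, (-1 : ℚ) ^ #W * ((if T ∪ W ⊆ rowSet g then 1 else 0 : ℕ) : ℚ) =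
        ∑ W ∈ (rowSet g \ T).powerset, (-1 : ℚ) ^ #W := by
      have : (rowSet g \ T).powerset = Tᶜ.powerset.filter fun W => T ∪ W ⊆ rowSet g := by
        ext W
        simp only [Finset.mem_powerset, Finset.mem_filter, Finset.union_subset_iff, hT, true_and,
          Finset.subset_sdiff, Finset.subset_compl_iff_disjoint_right]
        tauto
      rw [this, Finset.sum_filter]
      apply Finset.sum_congr rfl
      intro W _
      split_ifs <;> simp
    have h2 := congrArg (Int.cast : ℤ → ℚ) (Finset.sum_powerset_neg_one_pow_card (x := rowSet g \ T))
    push_cast at h2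
    rw [h1, h2]
    have : rowSet g \ T = ∅ ↔ rowSet g = T := by
      rw [Finset.sdiff_eq_empty_iff_subset]
      exact ⟨fun h => h.antisymm hT, fun h => h.le⟩
    simp [this]
  · have h1 : rowSet g ≠ T := fun h => hT h.ge
    have h2 : ∀ W, ¬ (T ∪ W ⊆ rowSet g) := fun W h => hT (Finset.union_subset_left h)
    simp [h1, h2]

lemma A_count {n : ℕ} (hn : 4 ≤ n) : (#((EQ n).filter fun g => #(rowSet g) = 3) : ℚ) =
    2 ^ 3 * (n.choose 3 : ℚ) *
          (∑ k ∈ Finset.range (n - 3 + 1), (-2 : ℚ) ^ k * ((n - 3).choose k : ℚ) *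
            ((n ^ 2 - 3 * n - n * k)! : ℚ) / ((n - k - 3)! : ℚ) ^ n) := by
  classical
  rw [Finset.card_eq_sum_card_fiberwise (f := fun g => rowSet g) (t := powersetCard 3 univ)
    (by intro g hg; simpa using (Finset.mem_filter.1 hg).2)]
  have hT : ∀ T ∈ powersetCard 3 (univ : Finset (Fin n)),
      ((#(((EQ n).filter fun g => #(rowSet g) = 3).filter fun g => rowSet g = T) : ℕ) : ℚ) =
      2 ^ 3 * (∑ k ∈ Finset.range (n - 3 + 1), (-2 : ℚ) ^ k * ((n - 3).choose k : ℚ) *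
            ((n ^ 2 - 3 * n - n * k)! : ℚ) / ((n - k - 3)! : ℚ) ^ n) := by
    intro T hT
    have hT3 : #T = 3 := (Finset.mem_powersetCard.1 hT).2
    have hTc : #Tᶜ = n - 3 := by rw [Finset.card_compl, hT3]; simp
    have h1 : ((EQ n).filter fun g => #(rowSet g) = 3).filter (fun g => rowSet g = T) =
      (EQ n).filter fun g => rowSet g = T := by
      rw [Finset.filter_filter]
      apply Finset.filter_congr
      intro g _
      constructor
      · exact fun h => h.2
      · exact fun h => ⟨by rw [h, hT3], h⟩
    rw [h1, incl_excl]
    have h2 : ∀ W ∈ Tᶜ.powerset, (-1 : ℚ) ^ #W * (#((EQ n).filter fun g => T ∪ W ⊆ rowSet g) : ℚ) =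
        (fun k => 2 ^ 3 * ((-2 : ℚ) ^ k * ((n ^ 2 - 3 * n - n * k)! : ℚ) / ((n - k - 3)! : ℚ) ^ n)) #W := by
      intro W hW
      rw [Finset.mem_powerset, Finset.subset_compl_iff_disjoint_right] at hW
      have hc : #(T ∪ W) = 3 + #W := by
        rw [Finset.card_union_of_disjoint hW.symm, hT3]
      have h3 := N_count (by omega) (T ∪ W)
      rw [hc] at h3
      have h4 : n * (n - (3 + #W)) = n ^ 2 - 3 * n - n * #W := by
        rw [Nat.mul_sub, mul_add, pow_two, Nat.sub_sub, mul_comm 3 n]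
      have h5 : n - (3 + #W) = n - #W - 3 := by omega
      rw [h4, h5] at h3
      have h6 := congrArg (Nat.cast : ℕ → ℚ) h3
      push_cast at h6
      have hne : ((n - #W - 3)! : ℚ) ^ n ≠ 0 := pow_ne_zero _ (by exact_mod_cast Nat.factorial_ne_zero _)
      rw [eq_comm] at h6
      have h7 : (#((EQ n).filter fun g => T ∪ W ⊆ rowSet g) : ℚ) =
        2 ^ (3 + #W) * ((n ^ 2 - 3 * n - n * #W)! : ℚ) / ((n - #W - 3)! : ℚ) ^ n := by
        rw [eq_div_iff hne, ← h6]
      rw [h7]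
      have : (-2 : ℚ) ^ #W = (-1) ^ #W * 2 ^ #W := by rw [← mul_pow]; norm_num
      simp only [this]
      ring
    refine ((Finset.sum_congr rfl h2).trans (Finset.sum_powerset_apply_card (fun k => 2 ^ 3 * ((-2 : ℚ) ^ k *
      ((n ^ 2 - 3 * n - n * k)! : ℚ) / ((n - k - 3)! : ℚ) ^ n)))).trans ?_
    rw [hTc, Finset.mul_sum]
    apply Finset.sum_congr rfl
    intro k _
    rw [nsmul_eq_mul]
    ring
  rw [Nat.cast_sum, Finset.sum_congr rfl hT, Finset.sum_const, Finset.card_powersetCard]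
  simp
  ring

end aux2

section aux3

lemma two_card {n : ℕ} {j : Fin n} (hj : j ≠ j.rev) :
    #(univ.filter fun k : Fin n => k = j ∨ k = j.rev) = 2 := by
  have : (univ.filter fun k : Fin n => k = j ∨ k = j.rev) = {j, j.rev} := by ext; simp
  rw [this, Finset.card_pair hj]

lemma two_card' {n : ℕ} {j : Fin n} (hj : j ≠ j.rev) :
    #(univ.filter fun k : Fin n => ¬ (k = j ∨ k = j.rev)) = n - 2 := by
  have := Finset.card_filter_add_card_filter_not (s := univ) (fun k : Fin n => k = j ∨ k = j.rev)
  rw [two_card hj] at this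
  simp only [Finset.card_univ, Fintype.card_fin] at this
  omega

open scoped Classical in
/-- Squares with two rows and one column fixed. -/
noncomputable def Q {n : ℕ} (x : Fin n × Bool) : Finset (Fin n → Fin n → Fin n) :=
  (EQ n).filter fun g => RowS g x.2 x.1 ∧ RowS g (!x.2) x.1.rev ∧ ColS g x.2 x.1

open scoped Classical in
/-- Squares with two rows and two columns fixed. -/
noncomputable def Q' {n : ℕ} (x : Fin n × Bool) : Finset (Fin n → Fin n → Fin n) :=
  (EQ n).filter fun g => (RowS g x.2 x.1 ∧ RowS g (!x.2) x.1.rev ∧ ColS g x.2 x.1) ∧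
    ColS g (!x.2) x.1.rev

/-- The pattern fixed by the rows and columns. -/
def hpat {n : ℕ} (j : Fin n) (s : Bool) (a b : Fin n) : Fin n :=
  if a = j then sg s b else if a = j.rev then sg (!s) b else if b = j then sg s a else sg (!s) a

lemma Q_card {n : ℕ} (hn : 4 ≤ n) {j : Fin n} (hj : j ≠ j.rev) (s : Bool) :
    #(Q (j, s)) * ((n - 2)! ^ 2 * (n - 3)! ^ (n - 2)) = (n ^ 2 - 3 * n + 2)! := by
  classical
  have hp := pat_count (n := n) (univ.filter fun p => p.1 = j ∨ p.1 = j.rev ∨ p.2 = j) (hpat j s)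
    (fun k => if k = j ∨ k = j.rev then n - 2 else n - 3) (by
      intro k
      rw [Finset.filter_filter]
      by_cases hk : k = j ∨ k = j.rev
      · have : (univ.filter fun p : Fin n × Fin n => (p.1 = j ∨ p.1 = j.rev ∨ p.2 = j) ∧
            hpat j s p.1 p.2 = k) = {(j, sg s k), (j.rev, sg (!s) k)} := by
          ext ⟨a, b⟩
          have e1 := sg_eq_iff s b k
          have e2 := sg_eq_iff (!s) b k
          have e3 := sg_eq_iff s a k
          have e4 := Fin.rev_rev j
          have e5 : sg s k = k ∨ sg s k = k.rev := by cases s <;> simp [sg]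
          simp only [Finset.mem_filter, Finset.mem_univ, true_and, Finset.mem_insert,
            Finset.mem_singleton, Prod.mk.injEq, hpat]
          grind
        rw [this, Finset.card_pair (by simp [hj]), if_pos hk]; omega
      · have : (univ.filter fun p : Fin n × Fin n => (p.1 = j ∨ p.1 = j.rev ∨ p.2 = j) ∧
            hpat j s p.1 p.2 = k) = {(j, sg s k), (j.rev, sg (!s) k), (sg s k, j)} := by
          ext ⟨a, b⟩
          have e1 := sg_eq_iff s b k
          have e2 := sg_eq_iff (!s) b k
          have e3 := sg_eq_iff s a k
          have e4 := Fin.rev_rev j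
          have e6 := Fin.rev_rev k
          have e5 : sg s k = k ∨ sg s k = k.rev := by cases s <;> simp [sg]
          simp only [Finset.mem_filter, Finset.mem_univ, true_and, Finset.mem_insert,
            Finset.mem_singleton, Prod.mk.injEq, hpat]
          grind
        have e4 := Fin.rev_rev j
        have e6 := Fin.rev_rev k
        have e5 : sg s k = k ∨ sg s k = k.rev := by cases s <;> simp [sg]
        have hc : #({(j, sg s k), (j.rev, sg (!s) k), (sg s k, j)} : Finset (Fin n × Fin n)) = 3 := by
          rw [Finset.card_eq_three]
          refine ⟨_, _, _, ?_, ?_, ?_, rfl⟩ <;> simp only [ne_eq, Prod.mk.injEq] <;> grind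
        rw [this, hc, if_neg hk]; omega)
  have h1 : ∀ k : Fin n, (if k = j ∨ k = j.rev then n - 2 else n - 3)! =
    if k = j ∨ k = j.rev then (n - 2)! else (n - 3)! := by intro k; split_ifs <;> rfl
  simp only [h1] at hp
  rw [Finset.prod_ite, Finset.sum_ite, Finset.prod_const, Finset.prod_const, Finset.sum_const,
    Finset.sum_const, two_card hj, two_card' hj] at hp
  have h2 : 2 • (n - 2) + (n - 2) • (n - 3) = n ^ 2 - 3 * n + 2 := by
    obtain ⟨m, rfl⟩ := Nat.exists_eq_add_of_le hn
    have : (4 + m) ^ 2 = 3 * (4 + m) + (m ^ 2 + 5 * m + 4) := by ring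
    rw [this, Nat.add_sub_cancel_left, show 4 + m - 2 = m + 2 by omega, show 4 + m - 3 = m + 1 by omega]
    simp only [smul_eq_mul]; ring
  rw [h2] at hp
  rw [← hp]
  congr 2
  ext g
  simp only [Q, Finset.mem_filter, Finset.mem_univ, true_and, mem_EQ]
  apply and_congr_right
  intro _
  constructor
  · rintro ⟨r1, r2, c1⟩ ⟨a, b⟩ hab
    have q1 := r1 b
    have q2 := r2 b
    have q3 := c1 a
    simp only [hpat] at *
    grind
  · intro h
    have hjj : j.rev ≠ j := hj.symm
    have r1 : RowS g s j := fun b => by simpa [hpat] using h (j, b) (by simp)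
    have r2 : RowS g (!s) j.rev := fun b => by simpa [hpat, hjj] using h (j.rev, b) (by simp)
    refine ⟨r1, r2, fun a => ?_⟩
    by_cases ha : a = j
    · subst ha; exact r1 a
    · by_cases ha' : a = j.rev
      · subst ha'
        show g j.rev j = sg s j.rev
        rw [r2 j]; cases s <;> simp [sg]
      · simpa [hpat, ha, ha'] using h (a, j) (by simp)

lemma Q'_card {n : ℕ} (hn : 4 ≤ n) {j : Fin n} (hj : j ≠ j.rev) (s : Bool) :
    #(Q' (j, s)) * ((n - 2)! ^ 2 * (n - 4)! ^ (n - 2)) = (n ^ 2 - 4 * n + 4)! := by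
  classical
  have hp := pat_count (n := n) (univ.filter fun p => p.1 = j ∨ p.1 = j.rev ∨ p.2 = j ∨ p.2 = j.rev)
    (hpat j s)
    (fun k => if k = j ∨ k = j.rev then n - 2 else n - 4) (by
      intro k
      rw [Finset.filter_filter]
      by_cases hk : k = j ∨ k = j.rev
      · have : (univ.filter fun p : Fin n × Fin n => (p.1 = j ∨ p.1 = j.rev ∨ p.2 = j ∨ p.2 = j.rev) ∧
            hpat j s p.1 p.2 = k) = {(j, sg s k), (j.rev, sg (!s) k)} := by
          ext ⟨a, b⟩
          have e1 := sg_eq_iff s b k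
          have e2 := sg_eq_iff (!s) b k
          have e3 := sg_eq_iff s a k
          have e3' := sg_eq_iff (!s) a k
          have e4 := Fin.rev_rev j
          have e5 : sg s k = k ∨ sg s k = k.rev := by cases s <;> simp [sg]
          have e5' : sg (!s) k = k ∨ sg (!s) k = k.rev := by cases s <;> simp [sg]
          simp only [Finset.mem_filter, Finset.mem_univ, true_and, Finset.mem_insert,
            Finset.mem_singleton, Prod.mk.injEq, hpat]
          grind
        rw [this, Finset.card_pair (by simp [hj]), if_pos hk]; omega
      · have : (univ.filter fun p : Fin n × Fin n => (p.1 = j ∨ p.1 = j.rev ∨ p.2 = j ∨ p.2 = j.rev) ∧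
            hpat j s p.1 p.2 = k) =
            {(j, sg s k), (j.rev, sg (!s) k), (sg s k, j), (sg (!s) k, j.rev)} := by
          ext ⟨a, b⟩
          have e1 := sg_eq_iff s b k
          have e2 := sg_eq_iff (!s) b k
          have e3 := sg_eq_iff s a k
          have e3' := sg_eq_iff (!s) a k
          have e4 := Fin.rev_rev j
          have e6 := Fin.rev_rev k
          have e5 : sg s k = k ∨ sg s k = k.rev := by cases s <;> simp [sg]
          have e5' : sg (!s) k = k ∨ sg (!s) k = k.rev := by cases s <;> simp [sg]
          simp only [Finset.mem_filter, Finset.mem_univ, true_and, Finset.mem_insert,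
            Finset.mem_singleton, Prod.mk.injEq, hpat]
          grind
        have e4 := Fin.rev_rev j
        have e6 := Fin.rev_rev k
        have e5 : sg s k = k ∨ sg s k = k.rev := by cases s <;> simp [sg]
        have e5' : sg (!s) k = k ∨ sg (!s) k = k.rev := by cases s <;> simp [sg]
        have hc : #({(j, sg s k), (j.rev, sg (!s) k), (sg s k, j), (sg (!s) k, j.rev)} :
            Finset (Fin n × Fin n)) = 4 := by
          rw [Finset.card_insert_of_notMem, Finset.card_eq_three.2]
          · refine ⟨_, _, _, ?_, ?_, ?_, rfl⟩ <;> simp only [ne_eq, Prod.mk.injEq] <;> grind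
          · simp only [Finset.mem_insert, Finset.mem_singleton, Prod.mk.injEq]; grind
        rw [this, hc, if_neg hk]; omega)
  have h1 : ∀ k : Fin n, (if k = j ∨ k = j.rev then n - 2 else n - 4)! =
    if k = j ∨ k = j.rev then (n - 2)! else (n - 4)! := by intro k; split_ifs <;> rfl
  simp only [h1] at hp
  rw [Finset.prod_ite, Finset.sum_ite, Finset.prod_const, Finset.prod_const, Finset.sum_const,
    Finset.sum_const, two_card hj, two_card' hj] at hp
  have h2 : 2 • (n - 2) + (n - 2) • (n - 4) = n ^ 2 - 4 * n + 4 := by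
    obtain ⟨m, rfl⟩ := Nat.exists_eq_add_of_le hn
    have : (4 + m) ^ 2 = 4 * (4 + m) + (m ^ 2 + 4 * m) := by ring
    rw [this, Nat.add_sub_cancel_left, Nat.add_sub_cancel_left, show 4 + m - 2 = m + 2 by omega]
    simp only [smul_eq_mul]; ring
  rw [h2] at hp
  rw [← hp]
  congr 2
  ext g
  simp only [Q', Finset.mem_filter, Finset.mem_univ, true_and, mem_EQ]
  apply and_congr_right
  intro _
  constructor
  · rintro ⟨⟨r1, r2, c1⟩, c2⟩ ⟨a, b⟩ hab
    have q1 := r1 b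
    have q2 := r2 b
    have q3 := c1 a
    have q4 := c2 a
    simp only [hpat] at *
    grind
  · intro h
    have hjj : j.rev ≠ j := hj.symm
    have r1 : RowS g s j := fun b => by simpa [hpat] using h (j, b) (by simp)
    have r2 : RowS g (!s) j.rev := fun b => by simpa [hpat, hjj] using h (j.rev, b) (by simp)
    refine ⟨⟨r1, r2, fun a => ?_⟩, fun a => ?_⟩
    · by_cases ha : a = j
      · subst ha; exact r1 a
      · by_cases ha' : a = j.rev
        · subst ha'
          show g j.rev j = sg s j.rev
          rw [r2 j]; cases s <;> simp [sg]
        · simpa [hpat, ha, ha'] using h (a, j) (by simp)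
    · show g a j.rev = sg (!s) a
      by_cases ha : a = j
      · subst ha
        rw [r1 a.rev]; cases s <;> simp [sg]
      · by_cases ha' : a = j.rev
        · subst ha'
          exact r2 _
        · simpa [hpat, ha, ha', hjj] using h (a, j.rev) (by simp)

lemma nonfixed_card {n : ℕ} :
    (#(univ.filter fun j : Fin n => j ≠ j.rev) : ℚ) = (n : ℚ) + (if Even n then 1 else 0) - 1 := by
  have h := Finset.card_filter_add_card_filter_not (s := univ) (fun j : Fin n => j = j.rev)
  simp only [Finset.card_univ, Fintype.card_fin] at h
  have h2 : #(univ.filter fun j : Fin n => j = j.rev) = if Even n then 0 else 1 := by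
    split_ifs with he
    · rw [Finset.card_eq_zero]
      apply Finset.eq_empty_of_forall_notMem
      intro j hj
      simp only [Finset.mem_filter, Finset.mem_univ, true_and, rev_iff] at hj
      obtain ⟨m, hm⟩ := he
      omega
    · rw [Nat.not_even_iff_odd] at he
      obtain ⟨m, hm⟩ := he
      rw [Finset.card_eq_one]
      refine ⟨⟨m, by omega⟩, ?_⟩
      ext j
      simp only [Finset.mem_filter, Finset.mem_univ, true_and, rev_iff, Finset.mem_singleton]
      rw [Fin.ext_iff]
      show _ ↔ (j : ℕ) = m
      omega
  have h3 := congrArg (Nat.cast : ℕ → ℚ) h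
  rw [h2] at h3
  push_cast at h3
  rw [← h3]
  split_ifs <;> simp

lemma B_set {n : ℕ} (hn : 4 ≤ n) (g : Fin n → Fin n → Fin n) (hg : g ∈ EQ n)
    (h2 : #(rowSet g) = 2) (h1 : #(colSet g) = 1) :
    ∃ x : Fin n × Bool, x.1 ≠ x.1.rev ∧ g ∈ Q x ∧ g ∉ Q' x := by
  obtain ⟨j, hj⟩ := Finset.card_eq_one.1 h1
  have hjc : j ∈ colSet g := by simp [hj]
  obtain ⟨s, hs⟩ := mem_colSet.1 hjc
  have hsub := rowSet_subset hs
  have hjj : j ≠ j.rev := by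
    intro h
    rw [← h] at hsub
    have := Finset.card_le_card hsub
    simp at this
    omega
  have heq : rowSet g = {j, j.rev} := Finset.eq_of_subset_of_card_le hsub (by
    rw [Finset.card_pair hjj, h2])
  obtain ⟨a, ha⟩ := mem_rowSet.1 (show j ∈ rowSet g by simp [heq])
  obtain ⟨b, hb⟩ := mem_rowSet.1 (show j.rev ∈ rowSet g by simp [heq])
  have ca := cross_s12 ha hs
  have cb := cross_s12 hb hs
  have ea : a = s := by
    by_contra h
    have e : (a == s) = false := by clear * - h; revert h; cases a <;> cases s <;> decide
    rw [e] at ca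
    exact hjj ca
  have eb : b = !s := by
    by_contra h
    have e : (b == s) = true := by clear * - h; revert h; cases b <;> cases s <;> decide
    rw [e] at cb
    exact hjj cb
  subst ea eb
  refine ⟨(j, a), hjj, ?_, ?_⟩
  · simp only [Q, Finset.mem_filter]
    exact ⟨hg, ha, hb, hs⟩
  · simp only [Q', Finset.mem_filter]
    rintro ⟨_, _, h⟩
    have : j.rev ∈ colSet g := mem_colSet.2 ⟨_, h⟩
    rw [hj] at this
    simp at this
    exact hjj this.symm

lemma B_set' {n : ℕ} (g : Fin n → Fin n → Fin n) (x : Fin n × Bool) (hx : x.1 ≠ x.1.rev)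
    (hQ : g ∈ Q x) (hQ' : g ∉ Q' x) :
    g ∈ EQ n ∧ #(rowSet g) = 2 ∧ colSet g = {x.1} ∧ ColS g x.2 x.1 := by
  obtain ⟨j, s⟩ := x
  simp only [Q, Finset.mem_filter] at hQ hx
  obtain ⟨hg, r1, r2, c1⟩ := hQ
  refine ⟨hg, ?_, ?_, c1⟩
  · have : rowSet g = {j, j.rev} := by
      apply (rowSet_subset c1).antisymm
      intro i hi
      simp only [Finset.mem_insert, Finset.mem_singleton] at hi
      rw [mem_rowSet]
      rcases hi with rfl | rfl
      · exact ⟨_, r1⟩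
      · exact ⟨_, r2⟩
    rw [this, Finset.card_pair hx]
  · ext i
    simp only [Finset.mem_singleton]
    constructor
    · intro hi
      have h1 := colSet_subset r1 hi
      simp only [Finset.mem_insert, Finset.mem_singleton] at h1
      rcases h1 with h1 | h1
      · exact h1
      · exfalso
        obtain ⟨t, ht⟩ := mem_colSet.1 hi
        have := cross_s12 r1 ht
        subst h1
        have et : t = !s := by
          by_contra h
          have e : (s == t) = true := by clear * - h; revert h; cases t <;> cases s <;> decide
          rw [e] at this
          exact hx this.symm
        subst et
        apply hQ'
        simp only [Q', Finset.mem_filter]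
        exact ⟨hg, ⟨r1, r2, c1⟩, ht⟩
    · rintro rfl
      exact mem_colSet.2 ⟨_, c1⟩

lemma B_count {n : ℕ} (hn : 4 ≤ n) :
    (#((EQ n).filter fun g => #(rowSet g) = 2 ∧ #(colSet g) = 1) : ℚ) =
    2 * ((n : ℚ) + (if Even n then 1 else 0) - 1) * (((n ^ 2 - 3 * n + 2)! : ℚ) /
            (((n - 2)! : ℚ) ^ 2 * ((n - 3)! : ℚ) ^ (n - 2))
        - ((n ^ 2 - 4 * n + 4)! : ℚ) /
            (((n - 2)! : ℚ) ^ 2 * ((n - 4)! : ℚ) ^ (n - 2))) := by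
  classical
  have hset : ((EQ n).filter fun g => #(rowSet g) = 2 ∧ #(colSet g) = 1) =
      ((univ.filter fun j : Fin n => j ≠ j.rev) ×ˢ (univ : Finset Bool)).biUnion
        fun x => Q x \ Q' x := by
    ext g
    simp only [Finset.mem_filter, Finset.mem_biUnion, Finset.mem_product, Finset.mem_univ, true_and,
      and_true, Finset.mem_sdiff]
    constructor
    · rintro ⟨h, h2, h1⟩
      exact B_set hn g h h2 h1
    · rintro ⟨x, hx, h, h'⟩
      obtain ⟨a, b, c, _⟩ := B_set' g x hx h h'
      exact ⟨a, b, by rw [c]; simp⟩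
  rw [hset, Finset.card_biUnion, Nat.cast_sum]
  · have hx : ∀ x ∈ ((univ.filter fun j : Fin n => j ≠ j.rev) ×ˢ (univ : Finset Bool)),
        ((#(Q x \ Q' x) : ℕ) : ℚ) = ((n ^ 2 - 3 * n + 2)! : ℚ) /
            (((n - 2)! : ℚ) ^ 2 * ((n - 3)! : ℚ) ^ (n - 2))
        - ((n ^ 2 - 4 * n + 4)! : ℚ) /
            (((n - 2)! : ℚ) ^ 2 * ((n - 4)! : ℚ) ^ (n - 2)) := by
      rintro ⟨j, s⟩ hx
      simp only [Finset.mem_product, Finset.mem_filter, Finset.mem_univ, true_and, and_true] at hx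
      have hsub : Q' (j, s) ⊆ Q (j, s) := by
        intro g hg
        simp only [Q, Q', Finset.mem_filter] at *
        exact ⟨hg.1, hg.2.1⟩
      rw [Finset.cast_card_sdiff hsub]
      have hf : ∀ m : ℕ, (m ! : ℚ) ≠ 0 := fun m => by exact_mod_cast Nat.factorial_ne_zero m
      have q1 := congrArg (Nat.cast : ℕ → ℚ) (Q_card hn hx s)
      have q2 := congrArg (Nat.cast : ℕ → ℚ) (Q'_card hn hx s)
      push_cast at q1 q2
      rw [← q1, ← q2, mul_div_cancel_right₀, mul_div_cancel_right₀]
      · exact mul_ne_zero (pow_ne_zero _ (hf _)) (pow_ne_zero _ (hf _))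
      · exact mul_ne_zero (pow_ne_zero _ (hf _)) (pow_ne_zero _ (hf _))
    rw [Finset.sum_congr rfl hx, Finset.sum_const, Finset.card_product, nsmul_eq_mul, Nat.cast_mul,
      nonfixed_card]
    simp only [Finset.card_univ, Fintype.card_bool]
    push_cast
    ring
  · intro x hx y hy hxy
    simp only [Finset.coe_product, Set.mem_prod, Finset.mem_coe, Finset.mem_filter, Finset.mem_univ, true_and,
      and_true] at hx hy
    show Disjoint _ _
    rw [Finset.disjoint_left]
    intro g h1 h2
    rw [Finset.mem_sdiff] at h1 h2
    obtain ⟨_, _, c, d⟩ := B_set' g x hx h1.1 h1.2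
    obtain ⟨_, _, c', d'⟩ := B_set' g y hy h2.1 h2.2
    rw [c] at c'
    have e := Finset.singleton_inj.1 c'
    apply hxy
    refine Prod.ext e ?_
    rw [← e] at d'
    exact colS_unique (by omega) d d'

end aux3

/-- For `n ≥ 4`, the number of equi-`n`-squares with exactly `3` consecutive or
reverse-consecutive lines. -/
theorem card_equiSquares_lineCount_three (n : ℕ) (hn : 4 ≤ n) :
    (Nat.card {g : Fin n → Fin n → Fin n //
        IsEquiSquare n g ∧ consecLineCount g = 3} : ℚ) =
      2 ^ 4 * (n.choose 3 : ℚ) *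
          (∑ k ∈ Finset.range (n - 3 + 1), (-2 : ℚ) ^ k * ((n - 3).choose k : ℚ) *
            ((n ^ 2 - 3 * n - n * k)! : ℚ) / ((n - k - 3)! : ℚ) ^ n)
        + 4 * ((n : ℚ) + (if Even n then 1 else 0) - 1) * ((n ^ 2 - 3 * n + 2)! : ℚ) /
            (((n - 2)! : ℚ) ^ 2 * ((n - 3)! : ℚ) ^ (n - 2))
        - 4 * ((n : ℚ) + (if Even n then 1 else 0) - 1) * ((n ^ 2 - 4 * n + 4)! : ℚ) /
            (((n - 2)! : ℚ) ^ 2 * ((n - 4)! : ℚ) ^ (n - 2)) := by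

  rw [total_split]
  push_cast
  rw [A_count hn, B_count hn]
  ring
end
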